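/- Let d ≥ 2 and 0 < α < d, and let P be a simple point process on ℝ^d satisfying Assumptions (A1) and (A2). Define the hybrid conductance profile ψ_L(t) = inf{ I³_U : ∅ ≠ U ⊆ ξ_L, #(U) ≤ t·#(ξ_L) }. Then for every ε > 0 there exists δ > 0 such that, P-a.s. for all sufficiently large L, ψ_L(t) ≥ δ·min{ L^{−ε}, t^{−1/d}·L^{−1} } for all 0 < t ≤ 1/2. -/

import Mathlib

open MeasureTheory Filter
open scoped ENNReal

noncomputable section

abbrev Pt (d : ℕ) := EuclideanSpace ℝ (Fin d)
abbrev Config (d : ℕ) := Set (Pt d)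

def IsLocallyFinite {d : ℕ} (ξ : Config d) : Prop :=
  ∀ A : Set (Pt d), Bornology.IsBounded A → (ξ ∩ A).Finite

instance configMS (d : ℕ) : MeasurableSpace (Config d) :=
  MeasurableSpace.generateFrom
    { E | ∃ (A : Set (Pt d)) (n : ℕ), Bornology.IsBounded A ∧ MeasurableSet A ∧
        E = {ξ : Config d | (ξ ∩ A).ncard = n} }

def IsPointProcess {d : ℕ} (P : Measure (Config d)) : Prop :=
  IsProbabilityMeasure P ∧ ∀ᵐ ξ ∂P, IsLocallyFinite ξ

def cube (d : ℕ) (L : ℝ) : Set (Pt d) := {p | ∀ i, |p i| ≤ L / 2}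

/-- The cube `B_x = Kx + [0,K)^d`. -/
def Kcube (d : ℕ) (K : ℝ) (x : Fin d → ℤ) : Set (Pt d) :=
  {p | ∀ i, K * x i ≤ p i ∧ p i < K * x i + K}

/-- Bernoulli(p) i.i.d. field on `ℤ^d`, characterized by its cylinder probabilities. -/
def IsBernoulliField (d : ℕ) (p : ℝ) (ν : Measure ((Fin d → ℤ) → Bool)) : Prop :=
  IsProbabilityMeasure ν ∧
  ∀ (S : Finset (Fin d → ℤ)) (b : (Fin d → ℤ) → Bool),
    ν {ω | ∀ x ∈ S, ω x = b x} = ∏ x ∈ S, ENNReal.ofReal (if b x then p else 1 - p)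

/-- Assumption (A1): for every p < 1 there is K such that the good-box field
dominates an i.i.d. Bernoulli(p) field, in the sense of a monotone coupling. -/
def AssumptionA1 {d : ℕ} (P : Measure (Config d)) : Prop :=
  ∀ p : ℝ, 0 < p → p < 1 → ∃ K : ℝ, 0 < K ∧
    ∃ (μ : Measure (Config d × ((Fin d → ℤ) → Bool))) (ν : Measure ((Fin d → ℤ) → Bool)),
      IsProbabilityMeasure μ ∧ IsBernoulliField d p ν ∧
      μ.map Prod.fst = P ∧ μ.map Prod.snd = ν ∧
      ∀ᵐ ω ∂μ, ∀ x : Fin d → ℤ, ω.2 x = true → (ω.1 ∩ Kcube d K x).Nonempty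

/-- `R_A(ξ) = Σ_{x ∈ ξ∩A} Σ_{y ∈ ξ} exp(-|x-y|^α)` (valued in `ℝ≥0∞`). -/
def Rfun {d : ℕ} (α : ℝ) (A : Set (Pt d)) (ξ : Config d) : ℝ≥0∞ :=
  ∑' (x : ↥(ξ ∩ A)) (y : ↥ξ), ENNReal.ofReal (Real.exp (-(dist (x : Pt d) (y : Pt d)) ^ α))

/-- The cube `V_x = L^ε x + [0, L^ε)^d`. -/
def Vcube (d : ℕ) (L : ℕ) (ε : ℝ) (x : Fin d → ℤ) : Set (Pt d) :=
  {p | ∀ i, (L : ℝ) ^ ε * x i ≤ p i ∧ p i < (L : ℝ) ^ ε * x i + (L : ℝ) ^ ε}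

/-- Assumption (A2). -/
def AssumptionA2 {d : ℕ} (α : ℝ) (P : Measure (Config d)) : Prop :=
  ∀ ε : ℝ, 0 < ε → ε < 1 → ∃ C : ℝ, 0 < C ∧
    ∀ᵐ ξ ∂P, ∀ᶠ L : ℕ in atTop,
      ∀ x : Fin d → ℤ, (Vcube d L ε x ∩ cube d L).Nonempty →
        Rfun α (Vcube d L ε x) ξ ≤ ENNReal.ofReal (C * (L : ℝ) ^ (ε * d))

noncomputable instance {d : ℕ} : DecidableEq (Pt d) := Classical.decEq _

variable {d : ℕ}

/-- jump rate `e^{-|x-y|^α}`. -/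
def rate (α : ℝ) (x y : Pt d) : ℝ := Real.exp (-(dist x y) ^ α)

/-- weights `w^i_x` for the three models `i = 1,2,3`. -/
def wgt (α : ℝ) (E : Finset (Pt d)) (i : ℕ) (x : Pt d) : ℝ :=
  if i = 1 then 1
  else if i = 2 then ∑ z ∈ E.erase x, rate α x z
  else max 1 (∑ z ∈ E.erase x, rate α x z)

/-- `W^i(U) = Σ_{x∈U} w^i_x`. -/
def Wsum (α : ℝ) (E : Finset (Pt d)) (i : ℕ) (U : Finset (Pt d)) : ℝ :=
  ∑ x ∈ U, wgt α E i x

/-- the reversible probability measure `ν^i(x) = w^i_x / W^i(ξ_L)`. -/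
def nu (α : ℝ) (E : Finset (Pt d)) (i : ℕ) (x : Pt d) : ℝ :=
  wgt α E i x / Wsum α E i E

/-- conductance `I^i_U`. -/
def conduct (α : ℝ) (E : Finset (Pt d)) (i : ℕ) (U : Finset (Pt d)) : ℝ :=
  (∑ x ∈ U, ∑ y ∈ E \ U, rate α x y) / Wsum α E i U

/-- isoperimetric profile `φ^i_L(t)` (valued in `ℝ≥0∞`; `∞` if no admissible `U`). -/
def isoProfile (α : ℝ) (E : Finset (Pt d)) (i : ℕ) (t : ℝ) : ℝ≥0∞ :=
  ⨅ (U : Finset (Pt d)) (_ : U ⊆ E) (_ : U.Nonempty)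
    (_ : Wsum α E i U ≤ t * Wsum α E i E), ENNReal.ofReal (conduct α E i U)

/-- Cheeger's constant `Φ^i_L = φ^i_L(1/2)`. -/
def cheeger (α : ℝ) (E : Finset (Pt d)) (i : ℕ) : ℝ≥0∞ := isoProfile α E i (1 / 2)

/-- Dirichlet form `E_i(f)`. -/
def dirichlet (α : ℝ) (E : Finset (Pt d)) (i : ℕ) (f : Pt d → ℝ) : ℝ :=
  (1 / 2) * ∑ x ∈ E, ∑ y ∈ E.erase x,
    nu α E i x * (rate α x y / wgt α E i x) * (f x - f y) ^ 2

/-- variance `Var_i(f) = ν^i(f²) - ν^i(f)²`. -/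
def varNu (α : ℝ) (E : Finset (Pt d)) (i : ℕ) (f : Pt d → ℝ) : ℝ :=
  (∑ x ∈ E, nu α E i x * f x ^ 2) - (∑ x ∈ E, nu α E i x * f x) ^ 2

/-- nonconstant on `E`. -/
def Nonconst (E : Finset (Pt d)) (f : Pt d → ℝ) : Prop := ∃ x ∈ E, ∃ y ∈ E, f x ≠ f y

/-- Poincaré constant `γ^i(L) = sup { Var_i f / E_i f : f nonconstant }`. -/
def gammaP (α : ℝ) (E : Finset (Pt d)) (i : ℕ) : ℝ≥0∞ :=
  ⨆ (f : Pt d → ℝ) (_ : Nonconst E f),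
    ENNReal.ofReal (varNu α E i f / dirichlet α E i f)

/-- the generator `L^i` as a matrix on `E`. -/
def gen (α : ℝ) (E : Finset (Pt d)) (i : ℕ) : Matrix ↥E ↥E ℝ :=
  Matrix.of fun x y =>
    if x = y then -(∑ z ∈ E.erase (x : Pt d), rate α (x : Pt d) z / wgt α E i (x : Pt d))
    else rate α (x : Pt d) (y : Pt d) / wgt α E i (x : Pt d)

/-- heat kernel `H^i_t = exp(t L^i)`, via the exponential series. -/
def heatKernel (α : ℝ) (E : Finset (Pt d)) (i : ℕ) (t : ℝ) (x y : ↥E) : ℝ :=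
  ∑' n : ℕ, t ^ n / (n.factorial : ℝ) * (gen α E i ^ n) x y

/-- uniform mixing time `τ^i(L)` (valued in `ℝ≥0∞`). -/
def mixTime (α : ℝ) (E : Finset (Pt d)) (i : ℕ) : ℝ≥0∞ :=
  ⨅ (t : ℝ) (_ : 0 < t)
    (_ : ∀ x y : ↥E,
      |heatKernel α E i t x y - nu α E i (y : Pt d)| / nu α E i (y : Pt d) ≤ Real.exp (-1)),
    ENNReal.ofReal t

/-- `c₀⁺(U)`: nonnegative, nonconstant, vanishing outside `U`. -/
def c0plus (E U : Finset (Pt d)) (f : Pt d → ℝ) : Prop :=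
  (∀ x ∈ E, 0 ≤ f x) ∧ Nonconst E f ∧ ∀ x ∈ E, x ∉ U → f x = 0

/-- `λ^i(U) = inf { E_i f / Var_i f : f ∈ c₀⁺(U) }`. -/
def lambdaU (α : ℝ) (E : Finset (Pt d)) (i : ℕ) (U : Finset (Pt d)) : ℝ :=
  sInf {r : ℝ | ∃ f : Pt d → ℝ, c0plus E U f ∧ r = dirichlet α E i f / varNu α E i f}

/-- `ν^i_* = min_{x∈E} ν^i(x)`. -/
def nuStar (α : ℝ) (E : Finset (Pt d)) (i : ℕ) : ℝ :=
  sInf (nu α E i '' ↑E)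

/-- `ν^i(U)` for a subset `U`. -/
def nuSet (α : ℝ) (E : Finset (Pt d)) (i : ℕ) (U : Finset (Pt d)) : ℝ :=
  ∑ x ∈ U, nu α E i x

/-- spectral profile `Λ^i(r)`. -/
def specProfile (α : ℝ) (E : Finset (Pt d)) (i : ℕ) (r : ℝ) : ℝ :=
  sInf {l : ℝ | ∃ U : Finset (Pt d), U ⊆ E ∧
    nuStar α E i ≤ nuSet α E i U ∧ nuSet α E i U ≤ r ∧ l = lambdaU α E i U}

/-- hybrid conductance profile `ψ_L(t)`: model-3 conductance, counting constraint. -/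
def hybridProfile (α : ℝ) (E : Finset (Pt d)) (t : ℝ) : ℝ≥0∞ :=
  ⨅ (U : Finset (Pt d)) (_ : U ⊆ E) (_ : U.Nonempty)
    (_ : (U.card : ℝ) ≤ t * (E.card : ℝ)), ENNReal.ofReal (conduct α E 3 U)

/-- The lattice point one unit above `x` in direction `i`. -/
def latticeStep (x : Fin d → ℕ) (i : Fin d) : Fin d → ℕ := Function.update x i (x i + 1)

/-- The discrete box `{0, …, n-1}^d`. -/
def latticeBox (d n : ℕ) : Finset (Fin d → ℕ) := Fintype.piFinset fun _ => Finset.range n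

/-- Adjacency (or equality) in the `ℓ^∞` sense. -/
def StarAdj (x y : Fin d → ℕ) : Prop := ∀ i, x i ≤ y i + 1 ∧ y i ≤ x i + 1

/-- Connectedness with respect to `StarAdj`. -/
def StarConn (S : Finset (Fin d → ℕ)) : Prop :=
  ∀ T ⊆ S, T.Nonempty → T ≠ S → ∃ x ∈ T, ∃ y ∈ S \ T, StarAdj x y

/-- Edges of the box `{0, …, n-1}^d` across which `f` changes value. -/
def edgeBoundary (n : ℕ) (f : (Fin d → ℕ) → ZMod 2) : Finset ((Fin d → ℕ) × Fin d) :=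
  (latticeBox d n ×ˢ Finset.univ).filter fun e =>
    e.1 e.2 + 1 < n ∧ f e.1 ≠ f (latticeStep e.1 e.2)

theorem mem_latticeBox {n : ℕ} {x : Fin d → ℕ} : x ∈ latticeBox d n ↔ ∀ i, x i < n := by
  simp [latticeBox]

theorem card_latticeBox (n : ℕ) : (latticeBox d n).card = n ^ d := by
  simp [latticeBox]

theorem latticeStep_self (x : Fin d → ℕ) (i : Fin d) : latticeStep x i i = x i + 1 := by
  simp [latticeStep]

theorem latticeStep_of_ne (x : Fin d → ℕ) {i j : Fin d} (h : j ≠ i) :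
    latticeStep x i j = x j := by
  simp [latticeStep, h]

theorem mem_edgeBoundary {n : ℕ} {f : (Fin d → ℕ) → ZMod 2} {x : Fin d → ℕ} {i : Fin d} :
    (x, i) ∈ edgeBoundary n f ↔
      x ∈ latticeBox d n ∧ x i + 1 < n ∧ f x ≠ f (latticeStep x i) := by
  simp [edgeBoundary]

theorem latticeStep_mem_latticeBox {n : ℕ} {x : Fin d → ℕ} {i : Fin d}
    (hx : x ∈ latticeBox d n) (hi : x i + 1 < n) : latticeStep x i ∈ latticeBox d n := by
  rw [mem_latticeBox] at hx ⊢
  intro j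
  by_cases h : j = i
  · subst h; rw [latticeStep_self]; exact hi
  · rw [latticeStep_of_ne _ h]; exact hx j

theorem StarAdj.symm {x y : Fin d → ℕ} (h : StarAdj x y) : StarAdj y x :=
  fun i => ⟨(h i).2, (h i).1⟩

theorem starAdj_latticeStep (x : Fin d → ℕ) (i : Fin d) : StarAdj x (latticeStep x i) := by
  intro j
  by_cases h : j = i
  · subst h; rw [latticeStep_self]; omega
  · rw [latticeStep_of_ne _ h]; omega

theorem exists_succ_ne {β : Type*} (φ : ℕ → β) {a b : ℕ} (h : φ a ≠ φ b) :
    ∃ t, min a b ≤ t ∧ t + 1 ≤ max a b ∧ φ t ≠ φ (t + 1) := by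
  wlog hab : a ≤ b generalizing a b
  · obtain ⟨t, h1, h2, h3⟩ := this h.symm (by omega)
    exact ⟨t, by omega, by omega, h3⟩
  by_contra! hc
  refine h ?_
  have : ∀ k, a + k ≤ b → φ a = φ (a + k) := by
    intro k
    induction k with
    | zero => simp
    | succ k ih =>
      intro hk
      rw [ih (by omega)]
      exact hc (a + k) (by omega) (by omega)
  have := this (b - a) (by omega)
  rwa [Nat.add_sub_cancel' hab] at this

/-- If `f` differs at `x` and `y`, it changes along some edge of the path that replaces the
coordinates of `x` by those of `y` one after the other. -/
theorem exists_latticeStep_ne {β : Type*} (f : (Fin d → ℕ) → β) {x y : Fin d → ℕ}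
    (h : f x ≠ f y) :
    ∃ (i : Fin d) (w : Fin d → ℕ), f w ≠ f (latticeStep w i) ∧ (∀ j < i, w j = y j) ∧
      (∀ j, i < j → w j = x j) ∧ min (x i) (y i) ≤ w i ∧ w i + 1 ≤ max (x i) (y i) := by
  set z : ℕ → Fin d → ℕ := fun k j => if j.val < k then y j else x j with hz
  have h0 : z 0 = x := by ext j; simp [hz]
  have hd : z d = y := by ext j; simp [hz]
  obtain ⟨k, -, hk, hne⟩ := exists_succ_ne (fun k => f (z k)) (a := 0) (b := d)
    (by simpa [h0, hd] using h)
  have hkd : k < d := by omega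
  set i : Fin d := ⟨k, hkd⟩ with hi
  have e1 : Function.update (z k) i (x i) = z k := by
    ext j
    by_cases hj : j = i
    · subst hj; simp [hz, hi]
    · simp [hj]
  have e2 : Function.update (z k) i (y i) = z (k + 1) := by
    ext j
    by_cases hj : j = i
    · subst hj; simp [hz, hi]
    · have : j.val ≠ k := fun hh => hj (Fin.ext hh)
      simp only [hz, ne_eq, hj, not_false_eq_true, Function.update_of_ne]
      by_cases hjk : j.val < k
      · simp [hjk, Nat.lt_succ_of_lt hjk]
      · have : ¬ j.val < k + 1 := by omega
        simp [hjk, this]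
  obtain ⟨t, ht1, ht2, ht3⟩ := exists_succ_ne (fun t => f (Function.update (z k) i t))
    (a := x i) (b := y i) (by simpa [e1, e2] using hne)
  refine ⟨i, Function.update (z k) i t, ?_, ?_, ?_, by simpa using ht1, by simpa using ht2⟩
  · simpa [latticeStep] using ht3
  · intro j hj
    have : j.val < k := hj
    simp [hj.ne, hz, this]
  · intro j hj
    have : ¬ j.val < k := by have : k < j.val := hj; omega
    simp [hj.ne', hz, this]

/-- A product of intervals is `StarAdj`-connected. -/
theorem starConn_piFinset_Ico (a b : Fin d → ℕ) :
    StarConn (Fintype.piFinset fun i => Finset.Ico (a i) (b i)) := by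
  intro T hT hne hTS
  obtain ⟨x, hx⟩ := hne
  obtain ⟨y, hy, hyT⟩ : ∃ y ∈ (Fintype.piFinset fun i => Finset.Ico (a i) (b i)), y ∉ T := by
    by_contra! hc
    exact hTS (Finset.Subset.antisymm hT hc)
  obtain ⟨i, w, hw, h1, h2, h3, h4⟩ := exists_latticeStep_ne (fun z => z ∈ T) (x := x) (y := y)
    (by simp [hx, hyT])
  have hxS := hT hx
  simp only [Fintype.mem_piFinset, Finset.mem_Ico] at hxS hy
  have hwS : w ∈ Fintype.piFinset fun i => Finset.Ico (a i) (b i) := by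
    simp only [Fintype.mem_piFinset, Finset.mem_Ico]
    intro j
    have := hxS j; have := hy j
    rcases lt_trichotomy j i with h | h | h
    · rw [h1 j h]; omega
    · subst h; omega
    · rw [h2 j h]; omega
  have hsS : latticeStep w i ∈ Fintype.piFinset fun i => Finset.Ico (a i) (b i) := by
    simp only [Fintype.mem_piFinset, Finset.mem_Ico] at hwS ⊢
    intro j
    have := hxS j; have := hy j
    by_cases h : j = i
    · subst h; rw [latticeStep_self]; omega
    · rw [latticeStep_of_ne _ h]; exact hwS j
  by_cases hwT : w ∈ T
  · refine ⟨w, hwT, latticeStep w i, ?_, starAdj_latticeStep w i⟩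
    rw [Finset.mem_sdiff]
    exact ⟨hsS, fun hh => hw (by simp [hwT, hh])⟩
  · have : latticeStep w i ∈ T := by
      by_contra hh
      exact hw (by simp [hwT, hh])
    exact ⟨latticeStep w i, this, w, by simp [hwS, hwT], (starAdj_latticeStep w i).symm⟩

theorem exists_scale {d a : ℕ} (hd : 2 ≤ d) (ha : 0 < a) :
    ∃ r : ℕ, 0 < r ∧ 2 * a ≤ r ^ d ∧ r ^ d ≤ 2 ^ (d + 1) * a ∧ ∀ n, 2 * a ≤ n ^ d → r ≤ n := by
  have hex : ∃ r : ℕ, 2 * a ≤ r ^ d := ⟨2 * a, Nat.le_self_pow (by omega) _⟩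
  classical
  have hr := Nat.find_spec hex
  have hmin : ∀ n, 2 * a ≤ n ^ d → Nat.find hex ≤ n := fun n hn => Nat.find_min' hex hn
  set r := Nat.find hex
  have h2 : 2 ≤ r := by
    by_contra hc
    have : r ^ d ≤ 1 := Nat.pow_le_one_iff (by omega) |>.2 (by omega)
    omega
  refine ⟨r, by omega, hr, ?_, hmin⟩
  have h3 : (r - 1) ^ d < 2 * a := by
    by_contra hc
    have := hmin (r - 1) (by omega)
    omega
  calc r ^ d ≤ (2 * (r - 1)) ^ d := Nat.pow_le_pow_left (by omega) d
    _ = 2 ^ d * (r - 1) ^ d := by rw [mul_pow]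
    _ ≤ 2 ^ d * (2 * a) := Nat.mul_le_mul_left _ h3.le
    _ = 2 ^ (d + 1) * a := by ring

/-- Isoperimetric inequality in the box `{0, …, n-1}^d`. -/
theorem card_pow_le_edgeBoundary (hd : 2 ≤ d) {n : ℕ} (f : (Fin d → ℕ) → ZMod 2) (v : ZMod 2)
    (hA : 2 * ((latticeBox d n).filter fun x => f x = v).card ≤ n ^ d) :
    ((latticeBox d n).filter fun x => f x = v).card ^ (d - 1) ≤
      2 ^ (d * (d + 3) + 1) * (edgeBoundary n f).card ^ d := by
  set A := (latticeBox d n).filter fun x => f x = v with hAdef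
  rcases Nat.eq_zero_or_pos A.card with h0 | hpos
  · rw [h0, zero_pow (by omega)]; exact Nat.zero_le _
  obtain ⟨r, hr0, hr1, hr2, hr3⟩ := exists_scale hd hpos
  have hrn := hr3 n hA
  -- pairs of nearby points separated by `A`
  set Q : (Fin d → ℕ) → Finset (Fin d → ℕ) := fun x =>
    Fintype.piFinset fun i => (Finset.range n).filter fun t => t < x i + r ∧ x i < t + r with hQ
  have hQcard : ∀ x ∈ A, r ^ d ≤ (Q x).card := by
    intro x hx
    have hxb := mem_latticeBox.1 (Finset.mem_filter.1 hx).1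
    have : ∀ i, r ≤ ((Finset.range n).filter fun t => t < x i + r ∧ x i < t + r).card := by
      intro i
      have hi := hxb i
      by_cases hc : x i + r ≤ n
      · calc r = (Finset.Ico (x i) (x i + r)).card := by simp
          _ ≤ _ := Finset.card_le_card (by
            intro t ht; simp only [Finset.mem_Ico, Finset.mem_filter, Finset.mem_range] at ht ⊢
            omega)
      · calc r = (Finset.Ico (n - r) n).card := by simp; omega
          _ ≤ _ := Finset.card_le_card (by
            intro t ht; simp only [Finset.mem_Ico, Finset.mem_filter, Finset.mem_range] at ht ⊢
            omega)
    rw [hQ, Fintype.card_piFinset]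
    calc r ^ d = ∏ _i : Fin d, r := by simp
      _ ≤ _ := Finset.prod_le_prod' fun i _ => this i
  set Pr := A.sigma fun x => Q x \ A with hPr
  have hlow : A.card * r ^ d ≤ 2 * Pr.card := by
    rw [hPr, Finset.card_sigma, Finset.mul_sum]
    calc A.card * r ^ d = ∑ x ∈ A, r ^ d := by simp
      _ ≤ _ := Finset.sum_le_sum fun x hx => by
        have h1 := hQcard x hx
        have h2 := Finset.le_card_sdiff A (Q x)
        omega
  have hup : Pr.card ≤ (edgeBoundary n f).card * (2 * r) ^ (d + 1) := by
    set fib : (Fin d → ℕ) × Fin d → Finset (Σ _ : Fin d → ℕ, Fin d → ℕ) := fun e =>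
      Pr.filter fun p => (∀ j < e.2, e.1 j = p.2 j) ∧ (∀ j, e.2 < j → e.1 j = p.1 j) ∧
        min (p.1 e.2) (p.2 e.2) ≤ e.1 e.2 ∧ e.1 e.2 + 1 ≤ max (p.1 e.2) (p.2 e.2) with hfib
    have hcov : Pr ⊆ (edgeBoundary n f).biUnion fib := by
      rintro ⟨x, y⟩ hp
      have hp' := hp
      simp only [hPr, Finset.mem_sigma, Finset.mem_sdiff, hQ, Fintype.mem_piFinset,
        Finset.mem_filter, Finset.mem_range] at hp'
      obtain ⟨hxA, hyQ, hyA⟩ := hp'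
      have hxA' := Finset.mem_filter.1 hxA
      have hxb := mem_latticeBox.1 hxA'.1
      have hyv : f y ≠ v := fun hh => hyA (by
        rw [hAdef, Finset.mem_filter, mem_latticeBox]
        exact ⟨fun i => (hyQ i).1, hh⟩)
      obtain ⟨i, w, hw, h1, h2, h3, h4⟩ := exists_latticeStep_ne f (x := x) (y := y)
        (by rw [hxA'.2]; exact hyv.symm)
      rw [Finset.mem_biUnion]
      refine ⟨(w, i), ?_, ?_⟩
      · rw [mem_edgeBoundary, mem_latticeBox]
        have a1 := hxb i
        have a2 := (hyQ i).1
        refine ⟨fun j => ?_, by omega, hw⟩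
        rcases lt_trichotomy j i with h | h | h
        · rw [h1 j h]; exact (hyQ j).1
        · subst h; omega
        · rw [h2 j h]; exact hxb j
      · rw [hfib, Finset.mem_filter]
        exact ⟨hp, h1, h2, h3, h4⟩
    refine (Finset.card_le_card hcov).trans (Finset.card_biUnion_le_card_mul _ _ _ ?_)
    rintro ⟨w, i⟩ -
    have hmap : (fib (w, i)).card ≤ ((Fintype.piFinset fun j => Finset.Ico (w j - r) (w j + r)) ×ˢ
        Finset.Ico (w i - r) (w i + r)).card := by
      refine Finset.card_le_card_of_injOn
        (fun p => (fun j => if j < i then p.1 j else p.2 j, p.1 i)) ?_ ?_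
      · rintro ⟨x, y⟩ hp
        simp only [hfib, hPr, Finset.coe_filter, Set.mem_ofPred_eq, Finset.mem_sigma,
          Finset.mem_sdiff, hQ, Fintype.mem_piFinset, Finset.mem_filter, Finset.mem_range] at hp
        obtain ⟨⟨-, hyQ, -⟩, h1, h2, h3, h4⟩ := hp
        simp only [Finset.coe_product, Set.mem_prod, Finset.mem_coe, Fintype.mem_piFinset,
          Finset.mem_Ico]
        refine ⟨fun j => ?_, ?_⟩
        · have := hyQ j
          rcases lt_trichotomy j i with h | h | h
          · rw [if_pos h, h1 j h]; omega
          · subst h; rw [if_neg (lt_irrefl _)]; omega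
          · rw [if_neg h.not_gt, h2 j h]; omega
        · have := hyQ i
          omega
      · rintro ⟨x, y⟩ hp ⟨x', y'⟩ hp' heq
        simp only [hfib, Finset.coe_filter, Set.mem_ofPred_eq] at hp hp'
        obtain ⟨-, h1, h2, -⟩ := hp
        obtain ⟨-, h1', h2', -⟩ := hp'
        simp only [Prod.mk.injEq] at heq
        obtain ⟨hq, hi⟩ := heq
        have hx : x = x' := by
          ext j
          rcases lt_trichotomy j i with h | h | h
          · simpa [h] using congrFun hq j
          · subst h; exact hi
          · rw [← h2 j h, ← h2' j h]
        have hy : y = y' := by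
          ext j
          rcases lt_trichotomy j i with h | h | h
          · rw [← h1 j h, ← h1' j h]
          · subst h; simpa using congrFun hq j
          · simpa [h.not_gt] using congrFun hq j
        subst hx; subst hy; rfl
    refine hmap.trans ?_
    rw [Finset.card_product, Fintype.card_piFinset, pow_succ]
    refine Nat.mul_le_mul ?_ (by simp; omega)
    calc _ ≤ ∏ _j : Fin d, 2 * r := Finset.prod_le_prod' fun j _ => by simp; omega
      _ = _ := by simp
  set a := A.card
  set b := (edgeBoundary n f).card
  have h1 : a * r ^ d ≤ (2 ^ (d + 2) * r * b) * r ^ d := by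
    calc a * r ^ d ≤ 2 * (b * (2 * r) ^ (d + 1)) := hlow.trans (Nat.mul_le_mul_left _ hup)
      _ = _ := by rw [mul_pow]; ring
  have h2 : a ≤ 2 ^ (d + 2) * r * b := Nat.le_of_mul_le_mul_right h1 (by positivity)
  have h3 : a ^ (d - 1) * a ≤ (2 ^ (d * (d + 3) + 1) * b ^ d) * a := by
    calc a ^ (d - 1) * a = a ^ d := by rw [← pow_succ]; congr 1; omega
      _ ≤ (2 ^ (d + 2) * r * b) ^ d := Nat.pow_le_pow_left h2 d
      _ = 2 ^ ((d + 2) * d) * r ^ d * b ^ d := by rw [mul_pow, mul_pow, ← pow_mul]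
      _ ≤ 2 ^ ((d + 2) * d) * (2 ^ (d + 1) * a) * b ^ d := by gcongr
      _ = _ := by ring
  exact Nat.le_of_mul_le_mul_right h3 hpos

theorem latticeStep_comm (x : Fin d → ℕ) (i j : Fin d) :
    latticeStep (latticeStep x i) j = latticeStep (latticeStep x j) i := by
  by_cases h : i = j
  · subst h; rfl
  · simp only [latticeStep, Function.update_of_ne (Ne.symm h), Function.update_of_ne h]
    exact Function.update_comm h _ _ _

/-- A closed `ZMod 2`-valued `1`-cochain on the box is exact. -/
theorem exists_primitive {n : ℕ} (D : (Fin d → ℕ) → Fin d → ZMod 2)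
    (hD : ∀ x ∈ latticeBox d n, ∀ i j, i ≠ j → x i + 1 < n → x j + 1 < n →
      D x i + D (latticeStep x i) j = D x j + D (latticeStep x j) i) :
    ∃ g : (Fin d → ℕ) → ZMod 2, ∀ x ∈ latticeBox d n, ∀ i, x i + 1 < n →
      D x i = g (latticeStep x i) - g x := by
  suffices h : ∀ S : Finset (Fin d), ∃ g : (Fin d → ℕ) → ZMod 2, ∀ x ∈ latticeBox d n,
      ∀ i ∈ S, x i + 1 < n → D x i = g (latticeStep x i) - g x by
    obtain ⟨g, hg⟩ := h Finset.univ
    exact ⟨g, fun x hx i => hg x hx i (Finset.mem_univ i)⟩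
  intro S
  induction S using Finset.induction_on with
  | empty => exact ⟨0, by simp⟩
  | insert i S hiS ih =>
    obtain ⟨g, hg⟩ := ih
    set E : (Fin d → ℕ) → Fin d → ZMod 2 := fun x j => D x j - (g (latticeStep x j) - g x)
      with hE
    have hEc : ∀ x ∈ latticeBox d n, ∀ i j, i ≠ j → x i + 1 < n → x j + 1 < n →
        E x i + E (latticeStep x i) j = E x j + E (latticeStep x j) i := by
      intro x hx i j hij hi hj
      have := hD x hx i j hij hi hj
      simp only [hE, latticeStep_comm x i j]
      linear_combination this
    have hE0 : ∀ x ∈ latticeBox d n, ∀ j ∈ S, x j + 1 < n → E x j = 0 := by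
      intro x hx j hj hxj
      simp only [hE]
      rw [hg x hx j hj hxj, sub_self]
    set g' : (Fin d → ℕ) → ZMod 2 :=
      fun x => ∑ k ∈ Finset.range (x i), E (Function.update x i k) i with hg'
    refine ⟨g + g', fun x hx j hj hxj => ?_⟩
    have hsuff : E x j = g' (latticeStep x j) - g' x := by
      by_cases hji : j = i
      · subst hji
        simp only [hg', latticeStep, Function.update_self, Function.update_idem]
        rw [Finset.sum_range_succ]
        simp
      · have hjS : j ∈ S := by simpa [hji] using hj
        rw [hE0 x hx j hjS hxj, eq_comm, sub_eq_zero]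
        simp only [hg']
        rw [latticeStep_of_ne x (Ne.symm hji)]
        refine Finset.sum_congr rfl fun k hk => ?_
        have hk' := Finset.mem_range.1 hk
        have hxi := mem_latticeBox.1 hx i
        set y := Function.update x i k with hy
        have hyb : y ∈ latticeBox d n := by
          rw [mem_latticeBox]
          intro l
          by_cases hl : l = i
          · subst hl; simp only [hy, Function.update_self]; omega
          · simp only [hy, ne_eq, hl, not_false_eq_true, Function.update_of_ne]
            exact mem_latticeBox.1 hx l
        have hyi : y i = k := by simp [hy]
        have hyj : y j = x j := by simp [hy, hji]
        have e1 : Function.update (latticeStep x j) i k = latticeStep y j := by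
          change Function.update (Function.update x j (x j + 1)) i k =
            Function.update y j (y j + 1)
          rw [hyj, hy]
          exact Function.update_comm hji _ _ _
        have hc := hEc y hyb i j (Ne.symm hji) (by omega) (by omega)
        rw [hE0 y hyb j hjS (by omega), hE0 (latticeStep y i)
          (latticeStep_mem_latticeBox hyb (by omega)) j hjS
          (by rw [latticeStep_of_ne _ hji]; omega)] at hc
        rw [e1]
        simpa using hc.symm
    simp only [hE] at hsuff
    simp only [Pi.add_apply]
    linear_combination hsuff

/-- Endpoints of the boundary edges of `f`. -/
def boundarySites (n : ℕ) (f : (Fin d → ℕ) → ZMod 2) : Finset (Fin d → ℕ) :=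
  (edgeBoundary n f).biUnion fun e => {e.1, latticeStep e.1 e.2}

theorem fst_mem_boundarySites {n : ℕ} {f : (Fin d → ℕ) → ZMod 2} {x : Fin d → ℕ} {i : Fin d}
    (h : (x, i) ∈ edgeBoundary n f) : x ∈ boundarySites n f :=
  Finset.mem_biUnion.2 ⟨_, h, by simp⟩

theorem latticeStep_mem_boundarySites {n : ℕ} {f : (Fin d → ℕ) → ZMod 2} {x : Fin d → ℕ}
    {i : Fin d} (h : (x, i) ∈ edgeBoundary n f) : latticeStep x i ∈ boundarySites n f :=
  Finset.mem_biUnion.2 ⟨_, h, by simp⟩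

theorem boundarySites_subset (n : ℕ) (f : (Fin d → ℕ) → ZMod 2) :
    boundarySites n f ⊆ latticeBox d n := by
  intro y hy
  obtain ⟨⟨x, i⟩, he, hy⟩ := Finset.mem_biUnion.1 hy
  obtain ⟨hx, hi, -⟩ := mem_edgeBoundary.1 he
  rcases Finset.mem_insert.1 hy with rfl | h
  · exact hx
  · rw [Finset.mem_singleton.1 h]; exact latticeStep_mem_latticeBox hx hi

theorem card_boundarySites_le (n : ℕ) (f : (Fin d → ℕ) → ZMod 2) :
    (boundarySites n f).card ≤ (edgeBoundary n f).card * 2 :=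
  Finset.card_biUnion_le_card_mul _ _ _ fun _ _ => Finset.card_le_two

/-- `C` is a union of `StarAdj`-components of `S`. -/
def StarClosed (S C : Finset (Fin d → ℕ)) : Prop :=
  C ⊆ S ∧ ∀ x ∈ C, ∀ y ∈ S, StarAdj x y → y ∈ C

theorem ZMod.two_sub_eq_one {a b : ZMod 2} (h : a ≠ b) : b - a = 1 := by
  revert a b; decide

theorem ZMod.two_eq_iff (a b : ZMod 2) : a = b ↔ b - a = 0 := by
  revert a b; decide

/-- A union of components of an edge boundary is itself an edge boundary. -/
theorem exists_edgeBoundary_component {n : ℕ} (f : (Fin d → ℕ) → ZMod 2)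
    {C : Finset (Fin d → ℕ)} (hC : StarClosed (boundarySites n f) C) :
    ∃ g : (Fin d → ℕ) → ZMod 2,
      (∀ x i, (x, i) ∈ edgeBoundary n g ↔ (x, i) ∈ edgeBoundary n f ∧ x ∈ C) ∧
      2 * ((latticeBox d n).filter fun x => g x = 1).card ≤ n ^ d := by
  classical
  set D : (Fin d → ℕ) → Fin d → ZMod 2 := fun x i =>
    if (x, i) ∈ edgeBoundary n f ∧ x ∈ C then 1 else 0 with hDdef
  have key : ∀ x ∈ latticeBox d n, ∀ i, x i + 1 < n → ∀ y ∈ C, StarAdj y x →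
      D x i = f (latticeStep x i) - f x := by
    intro x hx i hi y hy hyx
    simp only [hDdef]
    by_cases hf : f x = f (latticeStep x i)
    · rw [if_neg (fun h => (mem_edgeBoundary.1 h.1).2.2 hf), (ZMod.two_eq_iff _ _).1 hf]
    · have he : (x, i) ∈ edgeBoundary n f := mem_edgeBoundary.2 ⟨hx, hi, hf⟩
      rw [if_pos ⟨he, hC.2 y hy x (fst_mem_boundarySites he) hyx⟩, ZMod.two_sub_eq_one hf]
  have key0 : ∀ x, x ∉ C → ∀ i, D x i = 0 := by
    intro x hx i
    simp [hDdef, hx]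
  have hclosed : ∀ x ∈ latticeBox d n, ∀ i j, i ≠ j → x i + 1 < n → x j + 1 < n →
      D x i + D (latticeStep x i) j = D x j + D (latticeStep x j) i := by
    intro x hx i j hij hi hj
    by_cases hex : ∃ y ∈ C, StarAdj y x ∧ StarAdj y (latticeStep x i) ∧ StarAdj y (latticeStep x j)
    · obtain ⟨y, hy, h1, h2, h3⟩ := hex
      rw [key x hx i hi y hy h1, key x hx j hj y hy h1,
        key _ (latticeStep_mem_latticeBox hx hi) j (by rwa [latticeStep_of_ne _ hij.symm]) y hy h2,
        key _ (latticeStep_mem_latticeBox hx hj) i (by rwa [latticeStep_of_ne _ hij]) y hy h3,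
        latticeStep_comm x i j]
      ring
    · have hij' : StarAdj (latticeStep x i) (latticeStep x j) := by
        intro l
        simp only [latticeStep, Function.update_apply]
        split_ifs <;> subst_vars <;> omega
      have hrefl : ∀ z : Fin d → ℕ, StarAdj z z := fun z i => by omega
      have a1 : x ∉ C := fun h => hex ⟨x, h, hrefl x, starAdj_latticeStep x i,
        starAdj_latticeStep x j⟩
      have a2 : latticeStep x i ∉ C := fun h => hex ⟨_, h, (starAdj_latticeStep x i).symm,
        hrefl _, hij'⟩
      have a3 : latticeStep x j ∉ C := fun h => hex ⟨_, h, (starAdj_latticeStep x j).symm,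
        hij'.symm, hrefl _⟩
      rw [key0 _ a1, key0 _ a1, key0 _ a2, key0 _ a3]
  obtain ⟨g, hg⟩ := exists_primitive D hclosed
  have hmem : ∀ (c : ZMod 2) x i, (x, i) ∈ edgeBoundary n (fun z => g z + c) ↔
      (x, i) ∈ edgeBoundary n f ∧ x ∈ C := by
    intro c x i
    rw [mem_edgeBoundary]
    constructor
    · rintro ⟨hx, hi, hne⟩
      have h1 : D x i ≠ 0 := by
        rw [hg x hx i hi]
        intro h0
        exact hne (by rw [← (ZMod.two_eq_iff _ _).2 h0])
      by_contra hc
      exact h1 (by simp only [hDdef]; rw [if_neg hc])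
    · intro h
      obtain ⟨hx, hi, -⟩ := mem_edgeBoundary.1 h.1
      refine ⟨hx, hi, fun heq => ?_⟩
      have h1 : D x i = 1 := by simp only [hDdef]; rw [if_pos h]
      rw [hg x hx i hi, (ZMod.two_eq_iff _ _).1 (add_right_cancel heq)] at h1
      exact zero_ne_one h1
  have hsum : ((latticeBox d n).filter fun x => g x = 1).card +
      ((latticeBox d n).filter fun x => g x + 1 = 1).card = n ^ d := by
    rw [← card_latticeBox (d := d) n,
      ← Finset.card_filter_add_card_filter_not (s := latticeBox d n) (fun x => g x = 1)]
    congr 2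
    refine Finset.filter_congr fun x _ => ?_
    generalize g x = a
    revert a; decide
  rcases Nat.lt_or_ge (n ^ d) (2 * ((latticeBox d n).filter fun x => g x = 1).card) with h | h
  · exact ⟨fun z => g z + 1, hmem 1, by beta_reduce; omega⟩
  · exact ⟨g, by simpa using hmem 0, h⟩

/-- Cube of side `s` with lowest corner `a`. -/
def latticeCube (a : Fin d → ℕ) (s : ℕ) : Finset (Fin d → ℕ) :=
  Fintype.piFinset fun i => Finset.Ico (a i) (a i + s)

theorem card_latticeCube (a : Fin d → ℕ) (s : ℕ) : (latticeCube a s).card = s ^ d := by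
  simp [latticeCube]

theorem mem_latticeCube {a x : Fin d → ℕ} {s : ℕ} :
    x ∈ latticeCube a s ↔ ∀ i, a i ≤ x i ∧ x i < a i + s := by
  simp [latticeCube]

theorem starConn_latticeCube (a : Fin d → ℕ) (s : ℕ) : StarConn (latticeCube a s) :=
  starConn_piFinset_Ico _ _

/-- `x` lies in a subcube of side `s` of the box on which `f` is constant. -/
def InConstCube (n s : ℕ) (f : (Fin d → ℕ) → ZMod 2) (x : Fin d → ℕ) : Prop :=
  ∃ a : Fin d → ℕ, (∀ i, a i + s ≤ n) ∧ x ∈ latticeCube a s ∧ ∀ y ∈ latticeCube a s, f y = f x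

/-- All small components of the edge boundary of `f` can be erased without changing `f` on large
cubes where it is constant. -/
theorem exists_large_components (hd : 2 ≤ d) {n s k : ℕ}
    (hs : 2 ^ (d * (d + 3) + 1) * (d * k) ^ d < (s ^ d) ^ (d - 1)) (f : (Fin d → ℕ) → ZMod 2) :
    ∃ f' : (Fin d → ℕ) → ZMod 2, edgeBoundary n f' ⊆ edgeBoundary n f ∧
      (∀ x, InConstCube n s f x → f' x = f x) ∧
      ∀ C, StarClosed (boundarySites n f') C → C.Nonempty → k ≤ C.card := by
  classical
  let p : ℕ → Prop := fun m => ∃ f' : (Fin d → ℕ) → ZMod 2, edgeBoundary n f' ⊆ edgeBoundary n f ∧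
      (∀ x, InConstCube n s f x → f' x = f x) ∧ (edgeBoundary n f').card = m
  have hp : ∃ m, p m := ⟨_, f, Finset.Subset.refl _, fun _ _ => rfl, rfl⟩
  obtain ⟨f', h1, h2, h3⟩ := Nat.find_spec hp
  refine ⟨f', h1, h2, fun C hC hne => ?_⟩
  by_contra hk
  obtain ⟨g, hg1, hg2⟩ := exists_edgeBoundary_component f' hC
  have hgb : (edgeBoundary n g).card ≤ d * k := by
    calc (edgeBoundary n g).card ≤ (C ×ˢ (Finset.univ : Finset (Fin d))).card := by
          refine Finset.card_le_card ?_
          rintro ⟨x, i⟩ he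
          simpa using ((hg1 x i).1 he).2
      _ = C.card * d := by simp
      _ ≤ d * k := by rw [mul_comm]; exact Nat.mul_le_mul_left _ (by omega)
  have hiso := card_pow_le_edgeBoundary hd g 1 hg2
  have hsmall : ((latticeBox d n).filter fun x => g x = 1).card < s ^ d := by
    have : ((latticeBox d n).filter fun x => g x = 1).card ^ (d - 1) < (s ^ d) ^ (d - 1) :=
      (hiso.trans (Nat.mul_le_mul_left _ (Nat.pow_le_pow_left hgb d))).trans_lt hs
    exact lt_of_pow_lt_pow_left₀ _ (Nat.zero_le _) this
  have hg0 : ∀ x, InConstCube n s f x → g x = 0 := by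
    rintro x ⟨a, ha, hxa, hconst⟩
    have hcube : ∀ y ∈ latticeCube a s, y ∈ latticeBox d n := by
      intro y hy
      rw [mem_latticeBox]
      intro i
      have := mem_latticeCube.1 hy i
      have := ha i
      omega
    have hgc : ∀ y ∈ latticeCube a s, g y = g x := by
      intro y hy
      by_contra hyx
      obtain ⟨i, w, hw, q1, q2, q3, q4⟩ := exists_latticeStep_ne g hyx
      have hy' := mem_latticeCube.1 hy
      have hx' := mem_latticeCube.1 hxa
      have hwc : w ∈ latticeCube a s := by
        rw [mem_latticeCube]
        intro j
        have := hy' j; have := hx' j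
        rcases lt_trichotomy j i with h | h | h
        · rw [q1 j h]; omega
        · subst h; omega
        · rw [q2 j h]; omega
      have hsc : latticeStep w i ∈ latticeCube a s := by
        rw [mem_latticeCube] at hwc ⊢
        intro j
        have := hy' j; have := hx' j
        by_cases h : j = i
        · subst h; rw [latticeStep_self]; omega
        · rw [latticeStep_of_ne _ h]; exact hwc j
      have hwn : w i + 1 < n := by
        have := mem_latticeBox.1 (hcube _ hsc) i
        rwa [latticeStep_self] at this
      have he := h1 ((hg1 w i).1 (mem_edgeBoundary.2 ⟨hcube _ hwc, hwn, hw⟩)).1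
      exact (mem_edgeBoundary.1 he).2.2 ((hconst _ hwc).trans (hconst _ hsc).symm)
    by_contra hx0
    have hx1 : g x = 1 := by
      generalize g x = b at hx0
      revert b; decide
    have : s ^ d ≤ ((latticeBox d n).filter fun x => g x = 1).card := by
      rw [← card_latticeCube a s]
      refine Finset.card_le_card fun y hy => Finset.mem_filter.2 ⟨hcube y hy, ?_⟩
      rw [hgc y hy, hx1]
    omega
  have hsub : edgeBoundary n (f' + g) ⊂ edgeBoundary n f' := by
    have hiff : ∀ x i, (x, i) ∈ edgeBoundary n (f' + g) ↔ (x, i) ∈ edgeBoundary n f' ∧ x ∉ C := by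
      intro x i
      have hg := hg1 x i
      rw [mem_edgeBoundary] at hg ⊢
      rw [mem_edgeBoundary] at hg ⊢
      simp only [Pi.add_apply]
      by_cases hx : x ∈ latticeBox d n ∧ x i + 1 < n
      · simp only [hx.1, hx.2, true_and] at hg ⊢
        by_cases hxC : x ∈ C
        · simp only [hxC, and_true, not_true_eq_false, and_false, iff_false, not_not] at hg ⊢
          revert hg
          generalize f' x = p1; generalize f' (latticeStep x i) = p2
          generalize g x = p3; generalize g (latticeStep x i) = p4
          revert p1 p2 p3 p4; decide
        · simp only [hxC, and_false, iff_false, not_not, not_false_eq_true, and_true] at hg ⊢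
          rw [hg]; simp
      · constructor
        · rintro ⟨u, v, -⟩; exact absurd ⟨u, v⟩ hx
        · rintro ⟨⟨u, v, -⟩, -⟩; exact absurd ⟨u, v⟩ hx
    refine Finset.ssubset_iff_subset_ne.2 ⟨?_, ?_⟩
    · rintro ⟨x, i⟩ he
      exact ((hiff x i).1 he).1
    · intro heq
      obtain ⟨y, hy⟩ := hne
      obtain ⟨⟨x, i⟩, he, hy'⟩ := Finset.mem_biUnion.1 (hC.1 hy)
      have hx : x ∈ C := by
        rcases Finset.mem_insert.1 hy' with rfl | h
        · exact hy
        · rw [Finset.mem_singleton] at h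
          refine hC.2 y hy x (fst_mem_boundarySites he) ?_
          rw [h]
          exact (starAdj_latticeStep x i).symm
      rw [← heq] at he
      exact ((hiff x i).1 he).2 hx
  have hlt := Finset.card_lt_card hsub
  rw [h3] at hlt
  refine Nat.find_min hp hlt ⟨f' + g, hsub.subset.trans h1, fun x hx => ?_, rfl⟩
  simp [h2 x hx, hg0 x hx]

/-- Every large connected set of sites has at most a fraction `1 / H` of bad sites. -/
def FewBadSites (n k H : ℕ) (good : (Fin d → ℕ) → Prop) : Prop :=
  ∀ S ⊆ latticeBox d n, StarConn S → k ≤ S.card → ∀ B ⊆ S, S.card < H * B.card → ∃ x ∈ B, good x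

open Classical in
theorem FewBadSites.card_bad_le {n k H : ℕ} {good : (Fin d → ℕ) → Prop}
    (hg : FewBadSites n k H good) {S : Finset (Fin d → ℕ)} (hS : S ⊆ latticeBox d n)
    (hk : ∀ C, StarClosed S C → C.Nonempty → k ≤ C.card) :
    H * (S.filter fun x => ¬ good x).card ≤ S.card := by
  suffices h : ∀ m C, C.card = m → StarClosed S C →
      H * (C.filter fun x => ¬ good x).card ≤ C.card from
    h _ S rfl ⟨Finset.Subset.refl _, fun _ _ y hy _ => hy⟩
  intro m
  induction m using Nat.strong_induction_on with
  | _ m ih =>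
    rintro C rfl hC
    rcases C.eq_empty_or_nonempty with rfl | hne
    · simp
    by_cases hconn : StarConn C
    · by_contra hlt
      obtain ⟨x, hx, hgx⟩ := hg C (hC.1.trans hS) hconn (hk C hC hne) _
        (Finset.filter_subset (fun x => ¬ good x) C) (by omega)
      exact (Finset.mem_filter.1 hx).2 hgx
    · simp only [StarConn, not_forall, not_exists, not_and] at hconn
      obtain ⟨T, hTC, hTne, hTC', hadj⟩ := hconn
      have hss : T ⊂ C := Finset.ssubset_iff_subset_ne.2 ⟨hTC, hTC'⟩
      have h1 : StarClosed S T := by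
        refine ⟨hTC.trans hC.1, fun x hx y hy hxy => ?_⟩
        by_contra hyT
        exact hadj x hx y (Finset.mem_sdiff.2 ⟨hC.2 x (hTC hx) y hy hxy, hyT⟩) hxy
      have h2 : StarClosed S (C \ T) := by
        refine ⟨Finset.sdiff_subset.trans hC.1, fun x hx y hy hxy => ?_⟩
        have hxC := (Finset.mem_sdiff.1 hx).1
        refine Finset.mem_sdiff.2 ⟨hC.2 x hxC y hy hxy, fun hyT => ?_⟩
        exact hadj y hyT x hx hxy.symm
      have c1 := ih _ (Finset.card_lt_card hss) T rfl h1
      have c2 := ih _ (Finset.card_lt_card (Finset.sdiff_ssubset hTC hTne)) _ rfl h2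
      have e1 : (C.filter fun x => ¬ good x).card ≤ (T.filter fun x => ¬ good x).card +
          ((C \ T).filter fun x => ¬ good x).card := by
        rw [← Finset.card_union_of_disjoint
          (Finset.disjoint_filter_filter Finset.disjoint_sdiff), ← Finset.filter_union,
          Finset.union_sdiff_of_subset hTC]
      have e2 : T.card + (C \ T).card = C.card := by
        rw [← Finset.card_union_of_disjoint Finset.disjoint_sdiff,
          Finset.union_sdiff_of_subset hTC]
      calc _ ≤ H * ((T.filter fun x => ¬ good x).card +
          ((C \ T).filter fun x => ¬ good x).card) := Nat.mul_le_mul_left _ e1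
        _ ≤ _ := by rw [mul_add]; omega

open Classical in
/-- Boundary edges of `f` with two good endpoints. -/
def goodEdges (n : ℕ) (good : (Fin d → ℕ) → Prop) (f : (Fin d → ℕ) → ZMod 2) :
    Finset ((Fin d → ℕ) × Fin d) :=
  (edgeBoundary n f).filter fun e => good e.1 ∧ good (latticeStep e.1 e.2)

theorem latticeStep_injective (i : Fin d) :
    Function.Injective fun x : Fin d → ℕ => latticeStep x i := by
  intro x y h
  ext j
  have := congrFun h j
  by_cases hj : j = i
  · subst hj; simpa [latticeStep] using this
  · simpa [latticeStep, hj] using this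

open Classical in
theorem FewBadSites.card_edgeBoundary_le {n k : ℕ} {good : (Fin d → ℕ) → Prop}
    (hg : FewBadSites n k (8 * d) good) {f : (Fin d → ℕ) → ZMod 2}
    (hk : ∀ C, StarClosed (boundarySites n f) C → C.Nonempty → k ≤ C.card) :
    (edgeBoundary n f).card ≤ 2 * (goodEdges n good f).card := by
  have h1 := hg.card_bad_le (boundarySites_subset n f) hk
  have h2 := card_boundarySites_le n f
  set B := (boundarySites n f).filter fun x => ¬ good x with hB
  have hcov : edgeBoundary n f ⊆ goodEdges n good f ∪
      ((edgeBoundary n f).filter (fun e => ¬ good e.1) ∪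
        (edgeBoundary n f).filter fun e => ¬ good (latticeStep e.1 e.2)) := by
    intro e he
    simp only [goodEdges, Finset.mem_union, Finset.mem_filter, he, true_and]
    tauto
  have e1 : ((edgeBoundary n f).filter fun e => ¬ good e.1).card ≤ B.card * d := by
    calc _ ≤ (B ×ˢ (Finset.univ : Finset (Fin d))).card := by
          refine Finset.card_le_card ?_
          rintro ⟨x, i⟩ he
          obtain ⟨he, hx⟩ := Finset.mem_filter.1 he
          simpa [hB] using ⟨fst_mem_boundarySites he, hx⟩
      _ = _ := by simp
  have e2 : ((edgeBoundary n f).filter fun e => ¬ good (latticeStep e.1 e.2)).card ≤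
      B.card * d := by
    calc _ ≤ (B ×ˢ (Finset.univ : Finset (Fin d))).card := by
          refine Finset.card_le_card_of_injOn (fun e => (latticeStep e.1 e.2, e.2)) ?_ ?_
          · rintro ⟨x, i⟩ he
            obtain ⟨he, hx⟩ := Finset.mem_filter.1 (Finset.mem_coe.1 he)
            simpa [hB] using ⟨latticeStep_mem_boundarySites he, hx⟩
          · rintro ⟨x, i⟩ - ⟨y, j⟩ - h
            simp only [Prod.mk.injEq] at h
            obtain ⟨h, rfl⟩ := h
            rw [latticeStep_injective i h]
      _ = _ := by simp
  have e3 := (Finset.card_le_card hcov).trans ((Finset.card_union_le _ _).trans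
    (Nat.add_le_add_left (Finset.card_union_le _ _) _))
  have e4 : 8 * d * B.card = 8 * (B.card * d) := by ring
  omega

/-- Percolation isoperimetric inequality: if `f` takes each of its values on many large constant
cubes, then `f` has many good boundary edges. -/
theorem FewBadSites.card_pow_le_goodEdges (hd : 2 ≤ d) {n s k : ℕ} {good : (Fin d → ℕ) → Prop}
    (hg : FewBadSites n k (8 * d) good)
    (hs : 2 ^ (d * (d + 3) + 1) * (d * k) ^ d < (s ^ d) ^ (d - 1))
    (f : (Fin d → ℕ) → ZMod 2) (a : ℕ)
    (ha : ∀ v : ZMod 2, ∃ Y ⊆ latticeBox d n, a ≤ Y.card ∧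
      ∀ x ∈ Y, InConstCube n s f x ∧ f x = v) :
    a ^ (d - 1) ≤ 2 ^ (d * (d + 3) + 1) * (2 * (goodEdges n good f).card) ^ d := by
  obtain ⟨f', h1, h2, h3⟩ := exists_large_components (n := n) hd hs f
  have hle : ∀ v : ZMod 2, a ≤ ((latticeBox d n).filter fun x => f' x = v).card := by
    intro v
    obtain ⟨Y, hY, haY, hYf⟩ := ha v
    refine haY.trans (Finset.card_le_card fun x hx => Finset.mem_filter.2 ⟨hY hx, ?_⟩)
    rw [h2 x (hYf x hx).1, (hYf x hx).2]
  have hb : (edgeBoundary n f').card ≤ 2 * (goodEdges n good f).card := by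
    refine (hg.card_edgeBoundary_le h3).trans (Nat.mul_le_mul_left _ (Finset.card_le_card ?_))
    classical exact Finset.filter_subset_filter _ h1
  have hsum : ((latticeBox d n).filter fun x => f' x = 0).card +
      ((latticeBox d n).filter fun x => f' x = 1).card = n ^ d := by
    rw [← card_latticeBox (d := d) n,
      ← Finset.card_filter_add_card_filter_not (s := latticeBox d n) (fun x => f' x = 0)]
    congr 2
    refine Finset.filter_congr fun x _ => ?_
    generalize f' x = b
    revert b; decide
  obtain ⟨v, hv⟩ : ∃ v : ZMod 2, 2 * ((latticeBox d n).filter fun x => f' x = v).card ≤ n ^ d := by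
    rcases le_total ((latticeBox d n).filter fun x => f' x = 0).card
      ((latticeBox d n).filter fun x => f' x = 1).card with h | h
    · exact ⟨0, by omega⟩
    · exact ⟨1, by omega⟩
  calc a ^ (d - 1) ≤ _ := Nat.pow_le_pow_left (hle v) _
    _ ≤ _ := card_pow_le_edgeBoundary hd f' v hv
    _ ≤ _ := Nat.mul_le_mul_left _ (Nat.pow_le_pow_left hb d)

/-- The `StarAdj`-neighbours of `v`, including `v` itself. -/
def starNbrs (v : Fin d → ℕ) : Finset (Fin d → ℕ) :=
  Fintype.piFinset fun i => Finset.Icc (v i - 1) (v i + 1)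

theorem mem_starNbrs {v u : Fin d → ℕ} : u ∈ starNbrs v ↔ StarAdj v u := by
  simp only [starNbrs, Fintype.mem_piFinset, Finset.mem_Icc, StarAdj]
  exact forall_congr' fun i => by omega

theorem card_starNbrs_le (v : Fin d → ℕ) : (starNbrs v).card ≤ 3 ^ d := by
  rw [starNbrs, Fintype.card_piFinset]
  calc _ ≤ ∏ _i : Fin d, 3 := Finset.prod_le_prod' fun i _ => by simp; omega
    _ = 3 ^ d := by simp

/-- The sets of sites visited by the `StarAdj`-walks of a given length started at a given site. -/
def walkSets : ℕ → (Fin d → ℕ) → Finset (Finset (Fin d → ℕ))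
  | 0, v => {{v}}
  | m + 1, v => (starNbrs v).biUnion fun u => (walkSets m u).image (insert v)

theorem card_walkSets_le (m : ℕ) (v : Fin d → ℕ) : (walkSets m v).card ≤ (3 ^ d) ^ m := by
  induction m generalizing v with
  | zero => simp [walkSets]
  | succ m ih =>
    rw [walkSets, pow_succ']
    exact (Finset.card_biUnion_le_card_mul _ _ _ fun u _ =>
      Finset.card_image_le.trans (ih u)).trans (Nat.mul_le_mul_right _ (card_starNbrs_le v))

theorem self_mem_of_mem_walkSets {m : ℕ} {v : Fin d → ℕ} {T : Finset (Fin d → ℕ)}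
    (hT : T ∈ walkSets m v) : v ∈ T := by
  cases m with
  | zero => simp_all [walkSets]
  | succ m =>
    simp only [walkSets, Finset.mem_biUnion, Finset.mem_image] at hT
    obtain ⟨u, -, T', -, rfl⟩ := hT
    simp

/-- A walk can be extended by an excursion to a neighbour of a visited site. -/
theorem insert_mem_walkSets {m : ℕ} {v y u : Fin d → ℕ} {T : Finset (Fin d → ℕ)}
    (hT : T ∈ walkSets m v) (hy : y ∈ T) (hyu : StarAdj y u) :
    insert u T ∈ walkSets (m + 2) v := by
  have start : ∀ (m : ℕ) (v : Fin d → ℕ) (T : Finset (Fin d → ℕ)), T ∈ walkSets m v →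
      StarAdj v u → insert u T ∈ walkSets (m + 2) v := by
    intro m v T hT hvu
    have hv := self_mem_of_mem_walkSets hT
    simp only [walkSets, Finset.mem_biUnion, Finset.mem_image]
    refine ⟨u, mem_starNbrs.2 hvu, insert u T, ⟨v, mem_starNbrs.2 hvu.symm, T, hT, rfl⟩, ?_⟩
    rw [Finset.insert_comm, Finset.insert_eq_of_mem hv]
  induction m generalizing v T with
  | zero =>
    have : y = v := by simp_all [walkSets]
    subst this
    exact start 0 y T hT hyu
  | succ m ih =>
    by_cases hyv : y = v
    · subst hyv; exact start _ y T hT hyu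
    · rw [walkSets, Finset.mem_biUnion] at hT
      obtain ⟨w, hw, hT⟩ := hT
      obtain ⟨T', hT', rfl⟩ := Finset.mem_image.1 hT
      have := ih hT' (Finset.mem_of_mem_insert_of_ne hy hyv)
      rw [walkSets, Finset.mem_biUnion]
      exact ⟨w, hw, Finset.mem_image.2 ⟨_, this, Finset.insert_comm _ _ _⟩⟩

theorem StarConn.mem_walkSets {S : Finset (Fin d → ℕ)} (hS : StarConn S) {v : Fin d → ℕ}
    (hv : v ∈ S) : S ∈ walkSets (2 * (S.card - 1)) v := by
  have grow : ∀ j < S.card, ∃ T ⊆ S, v ∈ T ∧ T.card = j + 1 ∧ T ∈ walkSets (2 * j) v := by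
    intro j
    induction j with
    | zero => exact fun _ => ⟨{v}, by simpa using hv, by simp, by simp, by simp [walkSets]⟩
    | succ j ih =>
      intro hj
      obtain ⟨T, hTS, hvT, hTc, hTw⟩ := ih (by omega)
      obtain ⟨x, hx, y, hy, hxy⟩ := hS T hTS ⟨v, hvT⟩ (by rintro rfl; omega)
      obtain ⟨hyS, hyT⟩ := Finset.mem_sdiff.1 hy
      refine ⟨insert y T, Finset.insert_subset hyS hTS, Finset.mem_insert_of_mem hvT, ?_,
        insert_mem_walkSets hTw hx hxy⟩
      rw [Finset.card_insert_of_notMem hyT, hTc]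
  have hpos : 0 < S.card := Finset.card_pos.2 ⟨v, hv⟩
  obtain ⟨T, hTS, -, hTc, hTw⟩ := grow (S.card - 1) (by omega)
  rwa [Finset.eq_of_subset_of_card_le hTS (by omega)] at hTw

theorem IsBernoulliField.measure_forall_false_le {ν : Measure ((Fin d → ℤ) → Bool)} {θ : ℝ}
    {H m : ℕ} (hθ0 : 0 ≤ θ) (hθ1 : θ ≤ 1) (hν : IsBernoulliField d (1 - θ ^ H) ν)
    {c : (Fin d → ℕ) → Fin d → ℤ} (hc : Function.Injective c) {B : Finset (Fin d → ℕ)}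
    (hB : m < H * B.card) :
    ν {ω | ∀ x ∈ B, ω (c x) = false} ≤ ENNReal.ofReal θ ^ m := by
  classical
  have h := hν.2 (B.image c) fun _ => false
  have hset : {ω : (Fin d → ℤ) → Bool | ∀ x ∈ B.image c, ω x = false} =
      {ω | ∀ x ∈ B, ω (c x) = false} := by
    ext ω; simp
  rw [hset] at h
  rw [h]
  simp only [Bool.false_eq_true, if_false, sub_sub_cancel, Finset.prod_const,
    Finset.card_image_of_injective B hc]
  rw [ENNReal.ofReal_pow hθ0, ← pow_mul]
  exact pow_le_pow_right_of_le_one' (by simpa using hθ1) hB.le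

/-- Peierls estimate. -/
theorem IsBernoulliField.measure_not_fewBadSites_le {ν : Measure ((Fin d → ℤ) → Bool)} {H : ℕ}
    (hν : IsBernoulliField d (1 - ((4 * 9 ^ d)⁻¹ : ℝ) ^ H) ν)
    {c : (Fin d → ℕ) → Fin d → ℤ} (hc : Function.Injective c) (n : ℕ) {k : ℕ} (hk : 0 < k) :
    ν {ω | ¬ FewBadSites n k H fun x => ω (c x) = true} ≤ (n : ℝ≥0∞) ^ (2 * d) * 2⁻¹ ^ k := by
  classical
  set θ : ℝ := (4 * 9 ^ d)⁻¹ with hθ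
  have hθ0 : 0 ≤ θ := by positivity
  have hθ1 : θ ≤ 1 := inv_le_one_of_one_le₀ (by
    have : (1 : ℝ) ≤ 9 ^ d := one_le_pow₀ (by norm_num)
    linarith)
  have hcov : {ω : (Fin d → ℤ) → Bool | ¬ FewBadSites n k H fun x => ω (c x) = true} ⊆
      ⋃ v ∈ latticeBox d n, ⋃ m ∈ Finset.Icc k (n ^ d), ⋃ S ∈ (walkSets (2 * (m - 1)) v).filter
        (fun S => S.card = m), ⋃ B ∈ S.powerset.filter (fun B => m < H * B.card),
          {ω | ∀ x ∈ B, ω (c x) = false} := by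
    intro ω hω
    simp only [FewBadSites, Set.mem_ofPred_eq, not_forall, not_exists, not_and] at hω
    obtain ⟨S, hSn, hSc, hkS, B, hBS, hHB, hbad⟩ := hω
    obtain ⟨v, hv⟩ : S.Nonempty := Finset.card_pos.1 (by omega)
    simp only [Set.mem_iUnion, Finset.mem_filter, Finset.mem_powerset, Finset.mem_Icc]
    refine ⟨v, hSn hv, S.card, ⟨hkS, ?_⟩, S, ⟨hSc.mem_walkSets hv, rfl⟩, B, ⟨hBS, hHB⟩, ?_⟩
    · rw [← card_latticeBox (d := d) n]; exact Finset.card_le_card hSn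
    · intro x hx
      simpa using hbad x hx
  have hθE : (2 : ℝ≥0∞) * 9 ^ d * ENNReal.ofReal θ = 2⁻¹ := by
    have h : ENNReal.ofReal (2 * 9 ^ d * θ) = ENNReal.ofReal 2⁻¹ := by
      congr 1; rw [hθ]; field_simp; norm_num
    clear_value θ
    rw [ENNReal.ofReal_mul (by positivity), ENNReal.ofReal_mul (by positivity),
      ENNReal.ofReal_pow (by positivity), ENNReal.ofReal_inv_of_pos (by positivity)] at h
    simpa using h
  have hS : ∀ m ∈ Finset.Icc k (n ^ d), ∀ v : Fin d → ℕ,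
      ∑ S ∈ (walkSets (2 * (m - 1)) v).filter (fun S => S.card = m),
        ∑ B ∈ S.powerset.filter (fun B => m < H * B.card),
          ν {ω | ∀ x ∈ B, ω (c x) = false} ≤ 2⁻¹ ^ k := by
    intro m hm v
    have hm' := Finset.mem_Icc.1 hm
    have h1 : ∀ S ∈ (walkSets (2 * (m - 1)) v).filter (fun S => S.card = m),
        ∑ B ∈ S.powerset.filter (fun B => m < H * B.card),
          ν {ω | ∀ x ∈ B, ω (c x) = false} ≤ 2 ^ m * ENNReal.ofReal θ ^ m := by
      intro S hS
      have hSm := (Finset.mem_filter.1 hS).2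
      refine (Finset.sum_le_card_nsmul _ _ (ENNReal.ofReal θ ^ m) fun B hB =>
        hν.measure_forall_false_le hθ0 hθ1 hc (Finset.mem_filter.1 hB).2).trans ?_
      rw [nsmul_eq_mul]
      gcongr
      have := (Finset.card_filter_le S.powerset (fun B => m < H * B.card))
      rw [Finset.card_powerset, hSm] at this
      exact_mod_cast this
    refine (Finset.sum_le_card_nsmul _ _ _ h1).trans ?_
    rw [nsmul_eq_mul]
    have h2 : (((walkSets (2 * (m - 1)) v).filter (fun S => S.card = m)).card : ℝ≥0∞) ≤
        (9 ^ d) ^ m := by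
      have h3 := (Finset.card_filter_le (walkSets (2 * (m - 1)) v) (fun S => S.card = m)).trans
        (card_walkSets_le _ _)
      have h4 : ((3 : ℕ) ^ d) ^ (2 * (m - 1)) ≤ (9 ^ d) ^ m := by
        calc ((3 : ℕ) ^ d) ^ (2 * (m - 1)) ≤ (3 ^ d) ^ (2 * m) :=
              Nat.pow_le_pow_right (by positivity) (by omega)
          _ = (9 ^ d) ^ m := by
            rw [pow_mul, ← pow_mul 3 d 2, mul_comm d 2, pow_mul 3 2 d]; norm_num
      exact_mod_cast h3.trans h4
    calc _ ≤ ((9 : ℝ≥0∞) ^ d) ^ m * (2 ^ m * ENNReal.ofReal θ ^ m) := by gcongr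
      _ = (2 * 9 ^ d * ENNReal.ofReal θ) ^ m := by rw [mul_pow, mul_pow]; ring
      _ = 2⁻¹ ^ m := by rw [hθE]
      _ ≤ 2⁻¹ ^ k := pow_le_pow_right_of_le_one' (by simp) hm'.1
  calc _ ≤ _ := measure_mono hcov
    _ ≤ ∑ v ∈ latticeBox d n, ∑ m ∈ Finset.Icc k (n ^ d),
        ∑ S ∈ (walkSets (2 * (m - 1)) v).filter (fun S => S.card = m),
        ∑ B ∈ S.powerset.filter (fun B => m < H * B.card),
          ν {ω | ∀ x ∈ B, ω (c x) = false} := by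
      refine (measure_biUnion_finset_le _ _).trans (Finset.sum_le_sum fun v _ => ?_)
      refine (measure_biUnion_finset_le _ _).trans (Finset.sum_le_sum fun m _ => ?_)
      refine (measure_biUnion_finset_le _ _).trans (Finset.sum_le_sum fun S _ => ?_)
      exact measure_biUnion_finset_le _ _
    _ ≤ ∑ v ∈ latticeBox d n, ∑ m ∈ Finset.Icc k (n ^ d), (2⁻¹ : ℝ≥0∞) ^ k :=
      Finset.sum_le_sum fun v _ => Finset.sum_le_sum fun m hm => hS m hm v
    _ ≤ _ := by
      simp only [Finset.sum_const, card_latticeBox, nsmul_eq_mul, Nat.card_Icc]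
      rw [two_mul d, pow_add, ← mul_assoc]
      gcongr
      · push_cast; rfl
      · have : n ^ d + 1 - k ≤ n ^ d := by omega
        exact_mod_cast this

theorem measurable_ncard_inter_ne_zero {A : Set (Pt d)} (hA : Bornology.IsBounded A)
    (hA' : MeasurableSet A) : Measurable fun ξ : Config d => (ξ ∩ A).ncard ≠ 0 := by
  refine Measurable.not (measurableSet_setOfPred.1 ?_)
  exact MeasurableSpace.measurableSet_generateFrom ⟨A, 0, hA, hA', rfl⟩

theorem measurableSet_Kcube (K : ℝ) (x : Fin d → ℤ) : MeasurableSet (Kcube d K x) := by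
  have : Kcube d K x = ⋂ i, {p : Pt d | K * x i ≤ p i ∧ p i < K * x i + K} := by
    ext p; simp [Kcube]
  rw [this]
  refine MeasurableSet.iInter fun i => ?_
  have hm : Measurable fun p : Pt d => p i := by fun_prop
  exact (measurableSet_le measurable_const hm).inter (measurableSet_lt hm measurable_const)

theorem isBounded_Kcube (K : ℝ) (x : Fin d → ℤ) : Bornology.IsBounded (Kcube d K x) := by
  have h : Bornology.IsBounded ((EuclideanSpace.equiv (Fin d) ℝ).symm ''
      Set.pi Set.univ fun i => Set.Icc (K * x i : ℝ) (K * x i + K)) :=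
    ((isCompact_univ_pi fun i => isCompact_Icc).image
      (EuclideanSpace.equiv (Fin d) ℝ).symm.continuous).isBounded
  refine h.subset fun p hp => ⟨EuclideanSpace.equiv (Fin d) ℝ p, ?_, by simp⟩
  intro i _
  exact ⟨(hp i).1, (hp i).2.le⟩

/-- The threshold size beyond which connected sets in a box of side `L` have few bad sites. -/
def animalSize (d L : ℕ) : ℕ := (2 * d + 2) * (Nat.log 2 L + 1)

theorem tsum_peierls_ne_top (K : ℝ) (hK : 0 < K) :
    ∑' L : ℕ, (((2 * ⌊(L : ℝ) / (2 * K)⌋₊ : ℕ) : ℝ≥0∞) ^ (2 * d) * 2⁻¹ ^ animalSize d L) ≠ ⊤ := by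
  have hb : ∀ L : ℕ, (((2 * ⌊(L : ℝ) / (2 * K)⌋₊ : ℕ) : ℝ≥0∞) ^ (2 * d) * 2⁻¹ ^ animalSize d L) ≤
      ENNReal.ofReal (K⁻¹ ^ (2 * d) * (1 / (L : ℝ) ^ 2) + if L = 0 then 1 else 0) := by
    intro L
    have hn : ((2 * ⌊(L : ℝ) / (2 * K)⌋₊ : ℕ) : ℝ) ≤ L * K⁻¹ := by
      have := Nat.floor_le (show (0 : ℝ) ≤ (L : ℝ) / (2 * K) by positivity)
      push_cast
      calc _ ≤ 2 * ((L : ℝ) / (2 * K)) := by gcongr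
        _ = _ := by field_simp
    have e : (((2 * ⌊(L : ℝ) / (2 * K)⌋₊ : ℕ) : ℝ≥0∞) ^ (2 * d) * 2⁻¹ ^ animalSize d L) =
        ENNReal.ofReal (((2 * ⌊(L : ℝ) / (2 * K)⌋₊ : ℕ) : ℝ) ^ (2 * d) * 2⁻¹ ^ animalSize d L) := by
      rw [ENNReal.ofReal_mul (by positivity), ENNReal.ofReal_pow (by positivity),
        ENNReal.ofReal_pow (by positivity), ENNReal.ofReal_natCast,
        ENNReal.ofReal_inv_of_pos (by positivity), ENNReal.ofReal_ofNat]
    rw [e]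
    refine ENNReal.ofReal_le_ofReal ?_
    rcases Nat.eq_zero_or_pos L with rfl | hL
    · simp only [if_true]
      rcases Nat.eq_zero_or_pos d with rfl | hd
      · have : (2⁻¹ : ℝ) ^ animalSize 0 0 ≤ 1 := pow_le_one₀ (by norm_num) (by norm_num)
        simpa using this
      · rw [show ((2 * ⌊((0 : ℕ) : ℝ) / (2 * K)⌋₊ : ℕ) : ℝ) = 0 by simp, zero_pow (by omega)]
        simp
    · rw [if_neg hL.ne', add_zero]
      have hL' : (0 : ℝ) < L := by exact_mod_cast hL
      have h2 : (L : ℝ) ≤ 2 ^ (Nat.log 2 L + 1) := by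
        exact_mod_cast (Nat.lt_pow_succ_log_self (by norm_num) L).le
      have h3 : (2⁻¹ : ℝ) ^ animalSize d L ≤ ((L : ℝ) ^ (2 * d + 2))⁻¹ := by
        rw [inv_pow, animalSize, mul_comm, pow_mul]
        gcongr
      calc _ ≤ (L * K⁻¹) ^ (2 * d) * ((L : ℝ) ^ (2 * d + 2))⁻¹ := by gcongr
        _ = _ := by rw [mul_pow, pow_add]; field_simp
  refine ne_top_of_le_ne_top ?_ (ENNReal.tsum_le_tsum hb)
  rw [← ENNReal.ofReal_tsum_of_nonneg]
  · exact ENNReal.ofReal_ne_top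
  · intro L; positivity
  · refine Summable.add ?_ ?_
    · exact (Real.summable_one_div_nat_pow.2 (by norm_num)).mul_left _
    · exact summable_of_ne_finset_zero (s := {0}) (by intro b hb; simpa using hb)

theorem measurable_fewBadSites {n k H : ℕ} {good : Config d → (Fin d → ℕ) → Prop}
    (h : ∀ x, Measurable fun ξ => good ξ x) :
    Measurable fun ξ => FewBadSites n k H (good ξ) := by
  unfold FewBadSites
  refine Measurable.forall fun S => Measurable.imp measurable_const <|
    Measurable.imp measurable_const <| Measurable.imp measurable_const <|
    Measurable.forall fun B => Measurable.imp measurable_const <|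
    Measurable.imp measurable_const <| Measurable.exists fun x =>
    Measurable.and measurable_const (h x)

/-- A lattice site, shifted so that the box `{0, …, 2N-1}^d` is centred at the origin. -/
def centredSite (N : ℕ) (x : Fin d → ℕ) : Fin d → ℤ := fun i => (x i : ℤ) - N

theorem centredSite_injective (N : ℕ) :
    Function.Injective (centredSite N : (Fin d → ℕ) → Fin d → ℤ) := by
  intro x y h
  ext i
  have := congrFun h i
  simp only [centredSite] at this
  omega

theorem AssumptionA1.ae_fewBadSites {P : Measure (Config d)} (hA1 : AssumptionA1 P)
    (hP : IsPointProcess P) (hd : 0 < d) :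
    ∃ K : ℝ, 0 < K ∧ ∀ᵐ ξ ∂P, ∀ᶠ L : ℕ in atTop,
      FewBadSites (2 * ⌊(L : ℝ) / (2 * K)⌋₊) (animalSize d L) (8 * d) fun x =>
        (ξ ∩ Kcube d K (centredSite ⌊(L : ℝ) / (2 * K)⌋₊ x)).ncard ≠ 0 := by
  have hθ : (0 : ℝ) < ((4 * 9 ^ d)⁻¹ : ℝ) ^ (8 * d) := by positivity
  have hθ1 : ((4 * 9 ^ d)⁻¹ : ℝ) ^ (8 * d) < 1 := by
    refine pow_lt_one₀ (by positivity) (inv_lt_one_of_one_lt₀ ?_) (by omega)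
    have : (1 : ℝ) ≤ 9 ^ d := one_le_pow₀ (by norm_num)
    linarith
  obtain ⟨K, hK, μ, ν, hμ, hν, hfst, hsnd, hdom⟩ := hA1 (1 - ((4 * 9 ^ d)⁻¹ : ℝ) ^ (8 * d))
    (by linarith) (by linarith)
  refine ⟨K, hK, ?_⟩
  have hBC : ∀ᵐ ω ∂ν, ∀ᶠ L : ℕ in atTop,
      FewBadSites (2 * ⌊(L : ℝ) / (2 * K)⌋₊) (animalSize d L) (8 * d) fun x =>
        ω (centredSite ⌊(L : ℝ) / (2 * K)⌋₊ x) = true := by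
    have := ae_eventually_notMem (μ := ν) (s := fun L : ℕ => {ω |
      ¬ FewBadSites (2 * ⌊(L : ℝ) / (2 * K)⌋₊) (animalSize d L) (8 * d) fun x =>
        ω (centredSite ⌊(L : ℝ) / (2 * K)⌋₊ x) = true})
      (ne_top_of_le_ne_top (tsum_peierls_ne_top (d := d) K hK) (ENNReal.tsum_le_tsum fun L =>
        hν.measure_not_fewBadSites_le (centredSite_injective _) _ (by simp [animalSize])))
    simpa using this
  have hlf : ∀ᵐ ω ∂μ, IsLocallyFinite ω.1 :=
    ae_of_ae_map measurable_fst.aemeasurable (by rw [hfst]; exact hP.2)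
  have hBC' : ∀ᵐ ω ∂μ, ∀ᶠ L : ℕ in atTop,
      FewBadSites (2 * ⌊(L : ℝ) / (2 * K)⌋₊) (animalSize d L) (8 * d) fun x =>
        ω.2 (centredSite ⌊(L : ℝ) / (2 * K)⌋₊ x) = true :=
    ae_of_ae_map (p := fun ω : (Fin d → ℤ) → Bool => ∀ᶠ L : ℕ in atTop,
      FewBadSites (2 * ⌊(L : ℝ) / (2 * K)⌋₊) (animalSize d L) (8 * d) fun x =>
        ω (centredSite ⌊(L : ℝ) / (2 * K)⌋₊ x) = true)
      measurable_snd.aemeasurable (by rw [hsnd]; exact hBC)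
  rw [← hfst]
  rw [ae_map_iff measurable_fst.aemeasurable]
  · filter_upwards [hlf, hBC', hdom] with ω h1 h2 h3
    filter_upwards [h2] with L hL S hS hSc hk B hB hHB
    obtain ⟨x, hx, hω⟩ := hL S hS hSc hk B hB hHB
    refine ⟨x, hx, ?_⟩
    have hne := h3 _ hω
    beta_reduce
    rw [ne_eq, Set.ncard_eq_zero (h1 _ (isBounded_Kcube _ _))]
    exact hne.ne_empty
  · refine measurableSet_setOfPred.2 ?_
    simp only [eventually_atTop]
    refine Measurable.exists fun a => Measurable.forall fun L => Measurable.imp measurable_const ?_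
    exact measurable_fewBadSites fun x =>
      measurable_ncard_inter_ne_zero (isBounded_Kcube _ _) (measurableSet_Kcube _ _)

/-- The cells: cubes of side `s` (up to `2 * s - 1` on the far sides) partitioning the box
`{0, …, n-1}^d`. -/
def cellOf (n s : ℕ) (x : Fin d → ℕ) : Fin d → ℕ := fun i => min (x i / s) (n / s - 1)

theorem cellOf_mem {n s : ℕ} (hs : 0 < s) (hsn : s ≤ n) (x : Fin d → ℕ) :
    cellOf n s x ∈ latticeBox d (n / s) := by
  rw [mem_latticeBox]
  intro i
  have := Nat.div_pos hsn hs
  simp only [cellOf]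
  omega

theorem cellOf_eq_iff {n s : ℕ} (hs : 0 < s) {j : Fin d → ℕ} (hj : j ∈ latticeBox d (n / s))
    {x : Fin d → ℕ} (hx : x ∈ latticeBox d n) :
    cellOf n s x = j ↔
      ∀ i, j i * s ≤ x i ∧ x i < if j i + 1 = n / s then n else (j i + 1) * s := by
  rw [funext_iff]
  refine forall_congr' fun i => ?_
  have hj := mem_latticeBox.1 hj i
  have hx := mem_latticeBox.1 hx i
  have h1 : j i ≤ x i / s ↔ j i * s ≤ x i := Nat.le_div_iff_mul_le hs
  have h2 : x i / s < j i + 1 ↔ x i < (j i + 1) * s := Nat.div_lt_iff_lt_mul hs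
  simp only [cellOf]
  split_ifs with h
  · rw [← h1]; omega
  · rw [← h1, ← h2]
    omega

theorem cell_le {n s j : ℕ} (hj : j < n / s) :
    j * s + s ≤ if j + 1 = n / s then n else (j + 1) * s := by
  have : (j + 1) * s ≤ n := (Nat.mul_le_mul_right s hj).trans (Nat.div_mul_le_self n s)
  split_ifs <;> linarith [add_mul j 1 s]

theorem cell_bound_le {n s j : ℕ} (hj : j < n / s) :
    (if j + 1 = n / s then n else (j + 1) * s) ≤ n := by
  have : (j + 1) * s ≤ n := (Nat.mul_le_mul_right s hj).trans (Nat.div_mul_le_self n s)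
  split_ifs <;> omega

theorem latticeCube_subset_cell {n s : ℕ} (hs : 0 < s) {j : Fin d → ℕ}
    (hj : j ∈ latticeBox d (n / s)) {x : Fin d → ℕ} (hx : x ∈ latticeCube (fun i => j i * s) s) :
    x ∈ latticeBox d n ∧ cellOf n s x = j := by
  have hx := mem_latticeCube.1 hx
  have h1 : x ∈ latticeBox d n := mem_latticeBox.2 fun i => by
    have := cell_le (mem_latticeBox.1 hj i)
    have := cell_bound_le (mem_latticeBox.1 hj i)
    have := hx i
    omega
  refine ⟨h1, (cellOf_eq_iff hs hj h1).2 fun i => ?_⟩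
  have := cell_le (mem_latticeBox.1 hj i)
  have := hx i
  omega

/-- A set of points `E`, mapped to the sites of the box `{0, …, n-1}^d`, such that good sites
are occupied and bad sites are rare. The cells have side `s`, and `h`-cubes contain good sites. -/
structure SitePacking {V : Type*} (E : Finset V) (σ : V → Fin d → ℕ) (n k h s : ℕ)
    (good : (Fin d → ℕ) → Prop) : Prop where
  mem_box : ∀ p ∈ E, σ p ∈ latticeBox d n
  exists_of_good : ∀ x ∈ latticeBox d n, good x → ∃ p ∈ E, σ p = x
  few : FewBadSites n k (8 * d) good
  dim_pos : 0 < d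
  h_pos : 0 < h
  h_le : h ≤ s
  s_le : s ≤ n
  k_le : k ≤ h ^ d

namespace SitePacking

variable {V : Type*} {E : Finset V} {σ : V → Fin d → ℕ} {n k h s : ℕ}
  {good : (Fin d → ℕ) → Prop}

theorem s_pos (H : SitePacking E σ n k h s good) : 0 < s := H.h_pos.trans_le H.h_le

/-- The points of a cell. -/
def cellPts (E : Finset V) (σ : V → Fin d → ℕ) (n s : ℕ) (j : Fin d → ℕ) : Finset V :=
  E.filter fun p => cellOf n s (σ p) = j

theorem mem_cellPts {j : Fin d → ℕ} {p : V} :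
    p ∈ cellPts E σ n s j ↔ p ∈ E ∧ cellOf n s (σ p) = j := by
  simp [cellPts]

theorem card_le_two_mul_cellPts (H : SitePacking E σ n k h s good) {j : Fin d → ℕ}
    (hj : j ∈ latticeBox d (n / s)) : s ^ d ≤ 2 * (cellPts E σ n s j).card := by
  classical
  set S := latticeCube (fun i => j i * s) s with hS
  have hsub : S ⊆ latticeBox d n := fun x hx => (latticeCube_subset_cell H.s_pos hj hx).1
  have hc : S.card = s ^ d := card_latticeCube _ _
  have hbad : 8 * d * (S.filter fun x => ¬ good x).card ≤ S.card := by
    by_contra! hlt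
    obtain ⟨x, hx, hg⟩ := H.few S hsub (starConn_latticeCube _ _)
      (by rw [hc]; exact H.k_le.trans (Nat.pow_le_pow_left H.h_le d)) _
      (Finset.filter_subset _ _) hlt
    exact (Finset.mem_filter.1 hx).2 hg
  have hgood : (S.filter good).card ≤ (cellPts E σ n s j).card := by
    refine (Finset.card_le_card (t := (cellPts E σ n s j).image σ) fun x hx => ?_).trans
      Finset.card_image_le
    obtain ⟨hxS, hxg⟩ := Finset.mem_filter.1 hx
    obtain ⟨hxb, hxj⟩ := latticeCube_subset_cell H.s_pos hj hxS
    obtain ⟨p, hp, rfl⟩ := H.exists_of_good x hxb hxg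
    exact Finset.mem_image_of_mem _ (mem_cellPts.2 ⟨hp, hxj⟩)
  have hsum := Finset.card_filter_add_card_filter_not (s := S) (p := good)
  have hd := H.dim_pos
  have : 8 * (S.filter fun x => ¬ good x).card ≤ 8 * d * (S.filter fun x => ¬ good x).card :=
    Nat.mul_le_mul_right _ (by omega)
  omega

theorem cellPts_nonempty (H : SitePacking E σ n k h s good) {j : Fin d → ℕ}
    (hj : j ∈ latticeBox d (n / s)) : (cellPts E σ n s j).Nonempty := by
  have := H.card_le_two_mul_cellPts hj
  have := pow_pos H.s_pos d
  exact Finset.card_pos.1 (by omega)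

theorem nonempty (H : SitePacking E σ n k h s good) : Nonempty V := by
  obtain ⟨p, -⟩ := H.cellPts_nonempty (cellOf_mem H.s_pos H.s_le 0)
  exact ⟨p⟩

variable [DecidableEq V]

/-- In a cell containing both points of `U` and points outside `U`, there are two such points
close to each other. -/
theorem exists_close_pair (H : SitePacking E σ n k h s good) (U : Finset V) {j : Fin d → ℕ}
    (hj : j ∈ latticeBox d (n / s)) (r : ℕ) :
    ∀ p ∈ cellPts E σ n s j, p ∈ U → ∀ q ∈ cellPts E σ n s j, q ∉ U →
      (∀ i, σ p i ≤ σ q i + r ∧ σ q i ≤ σ p i + r) →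
      ∃ p' ∈ cellPts E σ n s j, p' ∈ U ∧ ∃ q' ∈ cellPts E σ n s j, q' ∉ U ∧
        ∀ i, σ p' i ≤ σ q' i + (2 * h + 2) ∧ σ q' i ≤ σ p' i + (2 * h + 2) := by
  induction r with
  | zero =>
    intro p hp hpU q hq hqU hr
    exact ⟨p, hp, hpU, q, hq, hqU, fun i => by have := hr i; omega⟩
  | succ r ih =>
    intro p hp hpU q hq hqU hr
    by_cases hrh : r + 1 ≤ 2 * h + 2
    · exact ⟨p, hp, hpU, q, hq, hqU, fun i => by have := hr i; omega⟩
    obtain ⟨hpE, hpj⟩ := mem_cellPts.1 hp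
    obtain ⟨hqE, hqj⟩ := mem_cellPts.1 hq
    have hpj := (cellOf_eq_iff H.s_pos hj (H.mem_box p hpE)).1 hpj
    have hqj := (cellOf_eq_iff H.s_pos hj (H.mem_box q hqE)).1 hqj
    set e : Fin d → ℕ := fun i => if j i + 1 = n / s then n else (j i + 1) * s with he
    set a : Fin d → ℕ := fun i => min ((σ p i + σ q i) / 2) (e i - h) with ha
    have hcell : ∀ x ∈ latticeCube a h, x ∈ latticeBox d n ∧ cellOf n s x = j ∧
        ∀ i, (x i ≤ σ p i + r ∧ σ p i ≤ x i + r) ∧ (x i ≤ σ q i + r ∧ σ q i ≤ x i + r) := by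
      intro x hx
      have hx := mem_latticeCube.1 hx
      have hbd : ∀ i, (j i * s ≤ x i ∧ x i < e i ∧ e i ≤ n) ∧
          (x i ≤ σ p i + r ∧ σ p i ≤ x i + r) ∧ (x i ≤ σ q i + r ∧ σ q i ≤ x i + r) := by
        intro i
        have h1 : j i * s + s ≤ e i := cell_le (mem_latticeBox.1 hj i)
        have h2 : e i ≤ n := cell_bound_le (mem_latticeBox.1 hj i)
        have h3 : j i * s ≤ σ p i ∧ σ p i < e i := hpj i
        have h4 : j i * s ≤ σ q i ∧ σ q i < e i := hqj i
        have h5 := hx i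
        have h6 : a i = min ((σ p i + σ q i) / 2) (e i - h) := rfl
        have h7 := hr i
        have h8 := H.h_le
        have h9 := H.h_pos
        omega
      have hxb : x ∈ latticeBox d n := mem_latticeBox.2 fun i => by have := hbd i; omega
      exact ⟨hxb, (cellOf_eq_iff H.s_pos hj hxb).2 fun i => ⟨(hbd i).1.1, (hbd i).1.2.1⟩,
        fun i => (hbd i).2⟩
    have hc : (latticeCube a h).card = h ^ d := card_latticeCube _ _
    have hpos : 0 < h ^ d := pow_pos H.h_pos d
    have hd := H.dim_pos
    obtain ⟨x, hx, hxg⟩ := H.few (latticeCube a h) (fun x hx => (hcell x hx).1)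
      (starConn_latticeCube _ _) (by rw [hc]; exact H.k_le) _ (Finset.Subset.refl _)
      (by rw [hc]; nlinarith)
    obtain ⟨hxb, hxj, hxr⟩ := hcell x hx
    obtain ⟨z, hzE, rfl⟩ := H.exists_of_good x hxb hxg
    have hz : z ∈ cellPts E σ n s j := mem_cellPts.2 ⟨hzE, hxj⟩
    by_cases hzU : z ∈ U
    · exact ih z hz hzU q hq hqU fun i => (hxr i).2
    · exact ih p hp hpU z hz hzU fun i => (hxr i).1.symm

/-- Cells all of whose points belong to `U`. -/
def fullCells (E : Finset V) (σ : V → Fin d → ℕ) (n s : ℕ) (U : Finset V) :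
    Finset (Fin d → ℕ) :=
  (latticeBox d (n / s)).filter fun j => cellPts E σ n s j ⊆ U

/-- Cells containing both points of `U` and points outside `U`. -/
def mixedCells (E : Finset V) (σ : V → Fin d → ℕ) (n s : ℕ) (U : Finset V) :
    Finset (Fin d → ℕ) :=
  (latticeBox d (n / s)).filter fun j =>
    ¬ cellPts E σ n s j ⊆ U ∧ ¬ cellPts E σ n s j ⊆ E \ U

theorem card_cells (H : SitePacking E σ n k h s good) (U : Finset V) :
    (fullCells E σ n s U).card + (fullCells E σ n s (E \ U)).card + (mixedCells E σ n s U).card =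
      (n / s) ^ d := by
  classical
  rw [← card_latticeBox (d := d) (n / s), ← Finset.card_union_of_disjoint,
    ← Finset.card_union_of_disjoint]
  · congr 1
    ext j
    simp only [fullCells, mixedCells, Finset.mem_union, Finset.mem_filter]
    tauto
  · rw [Finset.disjoint_left]
    intro j hj hj'
    simp only [fullCells, mixedCells, Finset.mem_union, Finset.mem_filter] at hj hj'
    tauto
  · rw [Finset.disjoint_left]
    intro j hj hj'
    simp only [fullCells, Finset.mem_filter] at hj hj'
    obtain ⟨p, hp⟩ := H.cellPts_nonempty hj.1
    exact (Finset.mem_sdiff.1 (hj'.2 hp)).2 (hj.2 hp)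

theorem sum_eq_sum_cells (H : SitePacking E σ n k h s good) {U : Finset V} (hU : U ⊆ E)
    (w : V → ℝ) :
    ∑ p ∈ U, w p = ∑ j ∈ latticeBox d (n / s), ∑ p ∈ U ∩ cellPts E σ n s j, w p := by
  classical
  rw [← Finset.sum_fiberwise_of_maps_to (g := fun p => cellOf n s (σ p))
    (t := latticeBox d (n / s)) (fun p _ => cellOf_mem H.s_pos H.s_le _)]
  refine Finset.sum_congr rfl fun j _ => Finset.sum_congr ?_ fun _ _ => rfl
  ext p
  simp only [Finset.mem_filter, Finset.mem_inter, mem_cellPts]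
  exact ⟨fun h => ⟨h.1, hU h.1, h.2⟩, fun h => ⟨h.1, h.2.2⟩⟩

/-- The total weight of `U` is controlled by the number of cells meeting `U`. -/
theorem sum_le (H : SitePacking E σ n k h s good) {U : Finset V} (hU : U ⊆ E)
    {w : V → ℝ} (hw : ∀ p, 0 ≤ w p) {A : ℝ}
    (hA : ∀ j ∈ latticeBox d (n / s), ∑ p ∈ cellPts E σ n s j, w p ≤ A) :
    ∑ p ∈ U, w p ≤ ((fullCells E σ n s U).card + (mixedCells E σ n s U).card : ℕ) * A := by
  classical
  have hdisj : Disjoint (fullCells E σ n s U) (mixedCells E σ n s U) := by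
    rw [Finset.disjoint_left]
    intro j hj hj'
    simp only [fullCells, mixedCells, Finset.mem_filter] at hj hj'
    tauto
  have hsub : fullCells E σ n s U ∪ mixedCells E σ n s U ⊆ latticeBox d (n / s) :=
    Finset.union_subset (Finset.filter_subset _ _) (Finset.filter_subset _ _)
  rw [H.sum_eq_sum_cells hU, ← Finset.card_union_of_disjoint hdisj, ← nsmul_eq_mul,
    ← Finset.sum_subset hsub]
  · refine Finset.sum_le_card_nsmul _ _ _ fun j hj => ?_
    exact (Finset.sum_le_sum_of_subset_of_nonneg Finset.inter_subset_right
      fun p _ _ => hw p).trans (hA j (hsub hj))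
  · intro j hj hj'
    simp only [fullCells, mixedCells, Finset.mem_union, Finset.mem_filter, hj, true_and,
      not_or, not_and, not_not] at hj'
    rw [Finset.sum_eq_zero]
    intro p hp
    obtain ⟨hpU, hpj⟩ := Finset.mem_inter.1 hp
    exact absurd hpU (Finset.mem_sdiff.1 (hj'.2 hj'.1 hpj)).2

theorem card_fullCells_mul_le (H : SitePacking E σ n k h s good) {U : Finset V} (hU : U ⊆ E) :
    (fullCells E σ n s U).card * s ^ d ≤ 2 * U.card := by
  classical
  have h1 := H.sum_eq_sum_cells hU fun _ => 1
  simp only [Finset.sum_const, nsmul_eq_mul, mul_one] at h1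
  have h2 : U.card = ∑ j ∈ latticeBox d (n / s), (U ∩ cellPts E σ n s j).card := by
    exact_mod_cast h1
  calc _ = ∑ _j ∈ fullCells E σ n s U, s ^ d := by simp
    _ ≤ ∑ j ∈ fullCells E σ n s U, 2 * (U ∩ cellPts E σ n s j).card := by
      refine Finset.sum_le_sum fun j hj => ?_
      obtain ⟨hj, hjU⟩ := Finset.mem_filter.1 hj
      rw [Finset.inter_eq_right.2 hjU]
      exact H.card_le_two_mul_cellPts hj
    _ ≤ ∑ j ∈ latticeBox d (n / s), 2 * (U ∩ cellPts E σ n s j).card :=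
      Finset.sum_le_sum_of_subset (Finset.filter_subset _ _)
    _ = _ := by rw [← Finset.mul_sum, ← h2]

theorem card_mul_le_cut {ι : Type*} {U : Finset V} {r : V → V → ℝ}
    (hr : ∀ p q, 0 ≤ r p q) {c : ℝ} (T : Finset ι) (g : ι → V × V) (hg : Set.InjOn g T)
    (hT : ∀ e ∈ T, (g e).1 ∈ U ∧ (g e).2 ∈ E \ U ∧ c ≤ r (g e).1 (g e).2) :
    T.card * c ≤ ∑ p ∈ U, ∑ q ∈ E \ U, r p q := by
  classical
  rw [← Finset.sum_product' (f := r)]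
  calc (T.card : ℝ) * c = ∑ _e ∈ T, c := by simp
    _ ≤ ∑ e ∈ T, r (g e).1 (g e).2 := Finset.sum_le_sum fun e he => (hT e he).2.2
    _ = ∑ x ∈ T.image g, r x.1 x.2 := (Finset.sum_image (f := fun x : V × V => r x.1 x.2) hg).symm
    _ ≤ _ := Finset.sum_le_sum_of_subset_of_nonneg (fun x hx => by
      obtain ⟨e, he, rfl⟩ := Finset.mem_image.1 hx
      exact Finset.mem_product.2 ⟨(hT e he).1, (hT e he).2.1⟩) fun _ _ _ => hr _ _

/-- Each mixed cell contributes to the cut. -/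
theorem card_mixedCells_mul_le (H : SitePacking E σ n k h s good) (U : Finset V)
    {r : V → V → ℝ} (hr : ∀ p q, 0 ≤ r p q) {c : ℝ}
    (hc : ∀ p ∈ E, ∀ q ∈ E,
      (∀ i, σ p i ≤ σ q i + (2 * h + 2) ∧ σ q i ≤ σ p i + (2 * h + 2)) → c ≤ r p q) :
    (mixedCells E σ n s U).card * c ≤ ∑ p ∈ U, ∑ q ∈ E \ U, r p q := by
  classical
  have hex : ∀ j ∈ mixedCells E σ n s U, ∃ e : V × V, e.1 ∈ U ∧ e.2 ∈ E \ U ∧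
      cellOf n s (σ e.1) = j ∧ c ≤ r e.1 e.2 := by
    intro j hj
    simp only [mixedCells, Finset.mem_filter, Finset.not_subset] at hj
    obtain ⟨hj, ⟨q, hq, hqU⟩, p, hp, hpU⟩ := hj
    have hpU : p ∈ U := by
      by_contra hcon
      exact hpU (Finset.mem_sdiff.2 ⟨(mem_cellPts.1 hp).1, hcon⟩)
    have hpn := mem_latticeBox.1 (H.mem_box p (mem_cellPts.1 hp).1)
    have hqn := mem_latticeBox.1 (H.mem_box q (mem_cellPts.1 hq).1)
    obtain ⟨p', hp', hpU', q', hq', hqU', hpq⟩ := H.exists_close_pair U hj n p hp hpU q hq hqU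
      fun i => by have := hpn i; have := hqn i; omega
    rw [mem_cellPts] at hp' hq'
    exact ⟨(p', q'), hpU', Finset.mem_sdiff.2 ⟨hq'.1, hqU'⟩, hp'.2, hc p' hp'.1 q' hq'.1 hpq⟩
  have := H.nonempty
  choose! g hg using hex
  refine card_mul_le_cut hr _ g (fun j hj j' hj' hjj => ?_) fun j hj =>
    ⟨(hg j hj).1, (hg j hj).2.1, (hg j hj).2.2.2⟩
  rw [← (hg j hj).2.2.1, ← (hg j' hj').2.2.1, hjj]

/-- The sites occupied by `U` or lying in a full cell. -/
def siteSet (E : Finset V) (σ : V → Fin d → ℕ) (n s : ℕ) (U : Finset V) (x : Fin d → ℕ) :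
    ZMod 2 :=
  open Classical in
  if (∃ p ∈ U, σ p = x) ∨ cellOf n s x ∈ fullCells E σ n s U then 1 else 0

theorem siteSet_eq_one {U : Finset V} {x : Fin d → ℕ} :
    siteSet E σ n s U x = 1 ↔
      (∃ p ∈ U, σ p = x) ∨ cellOf n s x ∈ fullCells E σ n s U := by
  rw [siteSet]
  split_ifs with h <;> simp [h]

/-- Each good edge in the boundary contributes to the cut. -/
theorem card_goodEdges_mul_le (H : SitePacking E σ n k h s good) {U : Finset V}
    {r : V → V → ℝ} (hr : ∀ p q, 0 ≤ r p q) {c : ℝ}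
    (hc : ∀ p ∈ E, ∀ q ∈ E, (∀ i, σ p i ≤ σ q i + 1 ∧ σ q i ≤ σ p i + 1) → c ≤ r p q) (hU : U ⊆ E) :
    (goodEdges n good (siteSet E σ n s U)).card * c ≤ ∑ p ∈ U, ∑ q ∈ E \ U, r p q := by
  classical
  set f := siteSet E σ n s U with hf
  have hone : ∀ x ∈ latticeBox d n, good x → f x = 1 → ∃ p ∈ U, σ p = x := by
    intro x hx hg h1
    rcases siteSet_eq_one.1 h1 with h | h
    · exact h
    · obtain ⟨p, hp, hpx⟩ := H.exists_of_good x hx hg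
      exact ⟨p, (Finset.mem_filter.1 h).2 (mem_cellPts.2 ⟨hp, by rw [hpx]⟩), hpx⟩
  have hzero : ∀ x ∈ latticeBox d n, good x → f x ≠ 1 → ∃ p ∈ E \ U, σ p = x := by
    intro x hx hg h1
    obtain ⟨p, hp, hpx⟩ := H.exists_of_good x hx hg
    exact ⟨p, Finset.mem_sdiff.2 ⟨hp, fun hpU => h1 (siteSet_eq_one.2 (.inl ⟨p, hpU, hpx⟩))⟩, hpx⟩
  have hex : ∀ e ∈ goodEdges n good f, ∃ g : V × V, g.1 ∈ U ∧ g.2 ∈ E \ U ∧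
      ((σ g.1 = e.1 ∧ σ g.2 = latticeStep e.1 e.2) ∨
        (σ g.2 = e.1 ∧ σ g.1 = latticeStep e.1 e.2)) := by
    rintro ⟨x, i⟩ he
    obtain ⟨he, hg1, hg2⟩ := Finset.mem_filter.1 he
    obtain ⟨hx, hi, hne⟩ := mem_edgeBoundary.1 he
    have hy := latticeStep_mem_latticeBox hx hi
    by_cases h1 : f x = 1
    · obtain ⟨p, hp, hpx⟩ := hone x hx hg1 h1
      obtain ⟨q, hq, hqx⟩ := hzero _ hy hg2 (by rw [← h1]; exact hne.symm)
      exact ⟨(p, q), hp, hq, .inl ⟨hpx, hqx⟩⟩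
    · have h2 : f (latticeStep x i) = 1 := by
        generalize f x = u at *
        generalize f (latticeStep x i) = v at *
        revert u v; decide
      obtain ⟨p, hp, hpx⟩ := hone _ hy hg2 h2
      obtain ⟨q, hq, hqx⟩ := hzero _ hx hg1 h1
      exact ⟨(p, q), hp, hq, .inr ⟨hqx, hpx⟩⟩
  have := H.nonempty
  choose! g hg using hex
  have hle : ∀ (x : Fin d → ℕ) (i j : Fin d), x j ≤ latticeStep x i j := by
    intro x i j
    by_cases hij : j = i
    · subst hij; rw [latticeStep_self]; omega
    · rw [latticeStep_of_ne _ hij]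
  have hstep : ∀ (x : Fin d → ℕ) (i i' : Fin d), latticeStep x i = latticeStep x i' → i = i' := by
    intro x i i' hii
    by_contra hne
    have := congrFun hii i
    rw [latticeStep_self, latticeStep_of_ne _ hne] at this
    omega
  have hcross : ∀ (x x' : Fin d → ℕ) (i i' : Fin d), x = latticeStep x' i' →
      x' = latticeStep x i → False := by
    intro x x' i i' h1 h2
    have h3 := congrFun h1 i'
    have h4 := congrFun h2 i'
    rw [latticeStep_self] at h3
    have := hle x i i'
    omega
  refine card_mul_le_cut hr _ g ?_ fun e he => ⟨(hg e he).1, (hg e he).2.1, ?_⟩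
  · rintro ⟨x, i⟩ he ⟨x', i'⟩ he' hee
    have h1 := (hg _ he).2.2
    have h2 := (hg _ he').2.2
    rw [← hee] at h2
    rcases h1 with ⟨a1, b1⟩ | ⟨a1, b1⟩ <;> rcases h2 with ⟨a2, b2⟩ | ⟨a2, b2⟩
    · have hxx : x = x' := a1.symm.trans a2
      subst hxx
      rw [hstep x i i' (b1.symm.trans b2)]
    · exact (hcross x x' i i' (a1.symm.trans b2) (a2.symm.trans b1)).elim
    · exact (hcross x x' i i' (a1.symm.trans b2) (a2.symm.trans b1)).elim
    · have hxx : x = x' := a1.symm.trans a2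
      subst hxx
      rw [hstep x i i' (b1.symm.trans b2)]
  · have hE1 := hU (hg e he).1
    have hE2 := (Finset.mem_sdiff.1 (hg e he).2.1).1
    refine hc _ hE1 _ hE2 ?_
    have hadj := starAdj_latticeStep e.1 e.2
    rcases (hg e he).2.2 with ⟨h1, h2⟩ | ⟨h1, h2⟩
    · rw [h1, h2]; exact hadj
    · rw [h1, h2]; exact hadj.symm

/-- Isoperimetry for the coarse-grained set. -/
theorem min_card_pow_le (H : SitePacking E σ n k h s good) (hd : 2 ≤ d)
    (hs : 2 ^ (d * (d + 3) + 1) * (d * k) ^ d < (s ^ d) ^ (d - 1)) {U : Finset V} (hU : U ⊆ E) :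
    (min (fullCells E σ n s U).card (fullCells E σ n s (E \ U)).card * s ^ d) ^ (d - 1) ≤
      2 ^ (d * (d + 3) + 1) * (2 * (goodEdges n good (siteSet E σ n s U)).card) ^ d := by
  classical
  refine H.few.card_pow_le_goodEdges hd hs _ _ ?_
  set f := siteSet E σ n s U with hf
  have key : ∀ (v : ZMod 2) (U' : Finset V), (∀ j ∈ fullCells E σ n s U',
      ∀ x ∈ latticeCube (fun i => j i * s) s, f x = v) →
      min (fullCells E σ n s U).card (fullCells E σ n s (E \ U)).card ≤
        (fullCells E σ n s U').card →
      ∃ Y ⊆ latticeBox d n,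
        min (fullCells E σ n s U).card (fullCells E σ n s (E \ U)).card * s ^ d ≤ Y.card ∧
        ∀ x ∈ Y, InConstCube n s f x ∧ f x = v := by
    intro v U' hv hmin
    have hmem : ∀ j ∈ fullCells E σ n s U', j ∈ latticeBox d (n / s) :=
      fun j hj => (Finset.mem_filter.1 hj).1
    refine ⟨(fullCells E σ n s U').biUnion fun j => latticeCube (fun i => j i * s) s, ?_, ?_, ?_⟩
    · intro x hx
      obtain ⟨j, hj, hx⟩ := Finset.mem_biUnion.1 hx
      exact (latticeCube_subset_cell H.s_pos (hmem j hj) hx).1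
    · rw [Finset.card_biUnion]
      · simp only [card_latticeCube, Finset.sum_const, smul_eq_mul]
        exact Nat.mul_le_mul_right _ hmin
      · intro j hj j' hj' hne
        refine Finset.disjoint_left.2 fun x hx hx' => ?_
        exact hne ((latticeCube_subset_cell H.s_pos (hmem j hj) hx).2.symm.trans
          (latticeCube_subset_cell H.s_pos (hmem j' hj') hx').2)
    · intro x hx
      obtain ⟨j, hj, hx⟩ := Finset.mem_biUnion.1 hx
      refine ⟨⟨fun i => j i * s, fun i => ?_, hx, fun y hy => ?_⟩, hv j hj x hx⟩
      · exact (cell_le (mem_latticeBox.1 (hmem j hj) i)).trans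
          (cell_bound_le (mem_latticeBox.1 (hmem j hj) i))
      · rw [hv j hj x hx, hv j hj y hy]
  intro v
  obtain rfl | rfl : v = 1 ∨ v = 0 := by revert v; decide
  · refine key 1 U (fun j hj x hx => siteSet_eq_one.2 (.inr ?_)) (min_le_left _ _)
    rwa [(latticeCube_subset_cell H.s_pos (Finset.mem_filter.1 hj).1 hx).2]
  · refine key 0 (E \ U) (fun j hj x hx => ?_) (min_le_right _ _)
    obtain ⟨hjb, hjU⟩ := Finset.mem_filter.1 hj
    have hxj := (latticeCube_subset_cell H.s_pos hjb hx).2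
    refine if_neg ?_
    rintro (⟨p, hp, rfl⟩ | hfull)
    · exact (Finset.mem_sdiff.1 (hjU (mem_cellPts.2 ⟨hU hp, hxj⟩))).2 hp
    · rw [hxj] at hfull
      obtain ⟨p, hp⟩ := H.cellPts_nonempty hjb
      exact (Finset.mem_sdiff.1 (hjU hp)).2 ((Finset.mem_filter.1 hfull).2 hp)

end SitePacking

namespace SitePacking

variable {V : Type*} [DecidableEq V] {E : Finset V} {σ : V → Fin d → ℕ} {n k h s : ℕ}
  {good : (Fin d → ℕ) → Prop}

/-- Either mixed cells dominate, or the isoperimetric inequality for the coarse-grained set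
controls the cut. -/
theorem cut_alternative (H : SitePacking E σ n k h s good) (hd : 2 ≤ d)
    (hs : 2 ^ (d * (d + 3) + 1) * (d * k) ^ d < (s ^ d) ^ (d - 1)) {U : Finset V} (hU : U ⊆ E)
    (hcard : 2 * U.card ≤ E.card) {w : V → ℝ} (hw : ∀ p, 1 ≤ w p) {C : ℝ} (hC : 0 < C)
    (hwC : ∀ j ∈ latticeBox d (n / s), ∑ p ∈ cellPts E σ n s j, w p ≤ C * (s : ℝ) ^ d)
    {r : V → V → ℝ} (hr : ∀ p q, 0 ≤ r p q) {c₀ c₁ κ : ℝ} (hc₀ : 0 ≤ c₀) (hc₁ : 0 ≤ c₁)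
    (hκ : 0 < κ) (hκ1 : κ ≤ 1) (hκC : 8 * C * κ ≤ 1)
    (hrc₀ : ∀ p ∈ E, ∀ q ∈ E, (∀ i, σ p i ≤ σ q i + 1 ∧ σ q i ≤ σ p i + 1) → c₀ ≤ r p q)
    (hrc₁ : ∀ p ∈ E, ∀ q ∈ E,
      (∀ i, σ p i ≤ σ q i + (2 * h + 2) ∧ σ q i ≤ σ p i + (2 * h + 2)) → c₁ ≤ r p q) :
    κ * c₁ * ∑ p ∈ U, w p ≤ 2 * C * (s : ℝ) ^ d * ∑ p ∈ U, ∑ q ∈ E \ U, r p q ∨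
    κ ^ (d - 1) * c₀ ^ d * (∑ p ∈ U, w p) ^ d ≤
      (2 * C) ^ d * 2 ^ (d * (d + 3) + 1) * 2 ^ (d + 1) *
        (U.card * (∑ p ∈ U, ∑ q ∈ E \ U, r p q) ^ d) := by
  have hw0 : ∀ p, 0 ≤ w p := fun p => zero_le_one.trans (hw p)
  have hUU : E \ (E \ U) = U := by rw [Finset.sdiff_sdiff_eq_self hU]
  have hmix : mixedCells E σ n s (E \ U) = mixedCells E σ n s U := by
    simp only [mixedCells, hUU, and_comm]
  have hWU := H.sum_le hU hw0 hwC
  have hWU' := H.sum_le Finset.sdiff_subset hw0 hwC (U := E \ U)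
  rw [hmix] at hWU'
  have hcardW : ((E \ U).card : ℝ) ≤ ∑ p ∈ E \ U, w p := by
    simpa using Finset.card_nsmul_le_sum (E \ U) w 1 fun p _ => hw p
  have hFU := H.card_fullCells_mul_le hU
  have hcutM := H.card_mixedCells_mul_le U hr hrc₁
  have hcutG := H.card_goodEdges_mul_le hr hrc₀ hU
  have hiso := H.min_card_pow_le hd hs hU
  have hsd : E.card = U.card + (E \ U).card := by
    have := Finset.card_sdiff_add_card_eq_card hU; omega
  set cut := ∑ p ∈ U, ∑ q ∈ E \ U, r p q with hcut
  set W := ∑ p ∈ U, w p with hW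
  set F := (fullCells E σ n s U).card with hF
  set F' := (fullCells E σ n s (E \ U)).card with hF'
  set M := (mixedCells E σ n s U).card with hM
  set G := (goodEdges n good (siteSet E σ n s U)).card with hG
  have hcut0 : 0 ≤ cut := Finset.sum_nonneg fun p _ => Finset.sum_nonneg fun q _ => hr p q
  have hW0 : 0 ≤ W := Finset.sum_nonneg fun p _ => hw0 p
  have hs0 : (0 : ℝ) < (s : ℝ) ^ d := pow_pos (by exact_mod_cast H.s_pos) d
  have hF0 : (0 : ℝ) ≤ F := F.cast_nonneg
  push_cast at hWU hWU'
  have hFU' : (F : ℝ) * (s : ℝ) ^ d ≤ 2 * U.card := by exact_mod_cast hFU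
  have hbal : (F : ℝ) ≤ 2 * C * (F' + M) := by
    have h1 : (U.card : ℝ) ≤ (E \ U).card := by
      have : U.card ≤ (E \ U).card := by omega
      exact_mod_cast this
    have h2 : (F : ℝ) * (s : ℝ) ^ d ≤ 2 * C * (F' + M) * (s : ℝ) ^ d := by
      calc _ ≤ 2 * ((F' + M) * (C * (s : ℝ) ^ d)) := by linarith
        _ = _ := by ring
    exact le_of_mul_le_mul_right h2 hs0
  rcases le_or_gt (κ * F) M with hcase | hcase
  · left
    have h1 : κ * (F + M) ≤ 2 * M := by
      have : κ * M ≤ 1 * M := by gcongr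
      linarith
    calc κ * c₁ * W ≤ κ * c₁ * ((F + M) * (C * (s : ℝ) ^ d)) := by gcongr
      _ = κ * (F + M) * (c₁ * C * (s : ℝ) ^ d) := by ring
      _ ≤ 2 * M * (c₁ * C * (s : ℝ) ^ d) := by gcongr
      _ = 2 * C * (s : ℝ) ^ d * (M * c₁) := by ring
      _ ≤ _ := by gcongr
  · right
    have hF'F : κ * F ≤ F' := by
      have h1 : (8 * C * κ) * F ≤ 1 * F := by gcongr
      have h2 : 2 * C * (κ * F) ≤ 2 * C * F' := by nlinarith
      exact le_of_mul_le_mul_left h2 (by positivity)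
    have hmin : κ * (F * (s : ℝ) ^ d) ≤ (min F F' * s ^ d : ℕ) := by
      push_cast
      rw [← mul_assoc]
      gcongr
      exact le_min (by nlinarith) hF'F
    have hM : (F : ℝ) + M ≤ 2 * F := by nlinarith
    set Q := (F : ℝ) * (s : ℝ) ^ d with hQ
    have hQ0 : 0 ≤ Q := by positivity
    have hWQ : W ≤ 2 * C * Q := by
      calc W ≤ (F + M) * (C * (s : ℝ) ^ d) := hWU
        _ ≤ 2 * F * (C * (s : ℝ) ^ d) := by gcongr
        _ = _ := by rw [hQ]; ring
    have hisoR : (κ * Q) ^ (d - 1) ≤ 2 ^ (d * (d + 3) + 1) * (2 * (G : ℝ)) ^ d := by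
      calc _ ≤ ((min F F' * s ^ d : ℕ) : ℝ) ^ (d - 1) := by gcongr
        _ ≤ _ := by exact_mod_cast hiso
    have hdd : Q ^ d = Q ^ (d - 1) * Q := by rw [← pow_succ]; congr 1; omega
    calc κ ^ (d - 1) * c₀ ^ d * W ^ d ≤ κ ^ (d - 1) * c₀ ^ d * (2 * C * Q) ^ d := by gcongr
      _ = (2 * C) ^ d * (κ * Q) ^ (d - 1) * c₀ ^ d * Q := by
        rw [mul_pow (2 * C) Q, hdd, mul_pow κ Q]; ring
      _ ≤ (2 * C) ^ d * (2 ^ (d * (d + 3) + 1) * (2 * (G : ℝ)) ^ d) * c₀ ^ d * (2 * U.card) := by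
        gcongr
      _ = (2 * C) ^ d * 2 ^ (d * (d + 3) + 1) * 2 ^ (d + 1) * (U.card * (G * c₀) ^ d) := by
        rw [mul_pow 2 (G : ℝ), mul_pow (G : ℝ) c₀]; ring
      _ ≤ _ := by gcongr

end SitePacking

/-- The site of the box `{0, …, 2N-1}^d` whose `K`-cube contains (or is adjacent to that
containing) the given point. -/
def siteOf (K : ℝ) (N : ℕ) (p : Pt d) : Fin d → ℕ :=
  fun i => min (⌊p i / K⌋ + N).toNat (2 * N - 1)

theorem siteOf_mem_latticeBox {K : ℝ} {N : ℕ} (hN : 0 < N) (p : Pt d) :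
    siteOf K N p ∈ latticeBox d (2 * N) := by
  rw [mem_latticeBox]
  intro i
  simp only [siteOf]
  omega

theorem siteOf_eq_of_mem_Kcube {K : ℝ} (hK : 0 < K) {N : ℕ} {x : Fin d → ℕ}
    (hx : x ∈ latticeBox d (2 * N)) {p : Pt d} (hp : p ∈ Kcube d K (centredSite N x)) :
    siteOf K N p = x := by
  ext i
  have hxi := mem_latticeBox.1 hx i
  have hfl : ⌊p i / K⌋ = (x i : ℤ) - N := by
    have := hp i
    simp only [centredSite] at this
    rw [Int.floor_eq_iff, le_div_iff₀ hK, div_lt_iff₀ hK]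
    constructor <;> linarith
  simp only [siteOf, hfl]
  omega

theorem mem_cube_of_mem_Kcube {K L : ℝ} (hK : 0 < K) {N : ℕ} (hN : K * N ≤ L / 2)
    {x : Fin d → ℕ} (hx : x ∈ latticeBox d (2 * N)) {p : Pt d}
    (hp : p ∈ Kcube d K (centredSite N x)) : p ∈ cube d L := by
  intro i
  have hxi : (x i : ℝ) + 1 ≤ 2 * N := by exact_mod_cast mem_latticeBox.1 hx i
  have := hp i
  simp only [centredSite] at this
  push_cast at this
  have h0 : (0 : ℝ) ≤ K * x i := by positivity
  have h1 : K * (x i + 1) ≤ K * (2 * N) := by gcongr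
  rw [abs_le]
  constructor <;> linarith

theorem abs_sub_siteOf_le {K L : ℝ} (hK : 0 < K) {N : ℕ} (hN0 : 0 < N)
    (hN : L / 2 < K * (N + 1)) {p : Pt d} (hp : p ∈ cube d L) (i : Fin d) :
    |p i - K * ((siteOf K N p i : ℝ) - N)| ≤ 2 * K := by
  have h1 := abs_le.1 (hp i)
  have hlo : -((N : ℤ) + 1) ≤ ⌊p i / K⌋ := by
    rw [Int.le_floor, le_div_iff₀ hK]; push_cast; linarith
  have hhi : ⌊p i / K⌋ < (N : ℤ) + 1 := by
    rw [Int.floor_lt, div_lt_iff₀ hK]; push_cast; linarith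
  have hs : -1 ≤ (siteOf K N p i : ℤ) - N - ⌊p i / K⌋ ∧
      (siteOf K N p i : ℤ) - N - ⌊p i / K⌋ ≤ 1 := by
    simp only [siteOf]; omega
  have hs1 : (-1 : ℝ) ≤ (siteOf K N p i : ℝ) - N - ⌊p i / K⌋ := by exact_mod_cast hs.1
  have hs2 : (siteOf K N p i : ℝ) - N - ⌊p i / K⌋ ≤ 1 := by exact_mod_cast hs.2
  have hf1 : K * ⌊p i / K⌋ ≤ p i := by
    have := (le_div_iff₀ hK).1 (Int.floor_le (p i / K)); linarith
  have hf2 : p i < K * ⌊p i / K⌋ + K := by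
    have := (div_lt_iff₀ hK).1 (Int.lt_floor_add_one (p i / K)); linarith
  have h2 := mul_le_mul_of_nonneg_left hs1 hK.le
  have h3 := mul_le_mul_of_nonneg_left hs2 hK.le
  rw [abs_le]
  constructor <;> linarith

theorem dist_le_of_abs_sub_le {p q : Pt d} {B : ℝ} (hB : 0 ≤ B) (h : ∀ i, |p i - q i| ≤ B) :
    dist p q ≤ d * B := by
  rw [EuclideanSpace.dist_eq]
  refine Real.sqrt_le_iff.2 ⟨by positivity, ?_⟩
  calc ∑ i, dist (p i) (q i) ^ 2 ≤ ∑ _i : Fin d, B ^ 2 := by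
        refine Finset.sum_le_sum fun i _ => ?_
        rw [Real.dist_eq]
        exact pow_le_pow_left₀ (abs_nonneg _) (h i) 2
    _ = d * B ^ 2 := by simp
    _ ≤ (d : ℝ) ^ 2 * B ^ 2 := by
      gcongr
      have : d ≤ d ^ 2 := Nat.le_self_pow (by norm_num) d
      exact_mod_cast this
    _ = _ := by ring

theorem exp_le_rate {α : ℝ} (hα : 0 < α) {K L : ℝ} (hK : 0 < K) {N : ℕ} (hN0 : 0 < N)
    (hN : L / 2 < K * (N + 1)) {p q : Pt d} (hp : p ∈ cube d L) (hq : q ∈ cube d L) {r : ℕ}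
    (hr : ∀ i, siteOf K N p i ≤ siteOf K N q i + r ∧ siteOf K N q i ≤ siteOf K N p i + r) :
    Real.exp (-(d * (K * (r + 4))) ^ α) ≤ rate α p q := by
  refine Real.exp_le_exp.2 (neg_le_neg (Real.rpow_le_rpow dist_nonneg ?_ hα.le))
  refine dist_le_of_abs_sub_le (by positivity) fun i => ?_
  have h1 := abs_le.1 (abs_sub_siteOf_le hK hN0 hN hp i)
  have h2 := abs_le.1 (abs_sub_siteOf_le hK hN0 hN hq i)
  have h3 : (siteOf K N p i : ℝ) ≤ siteOf K N q i + r := by exact_mod_cast (hr i).1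
  have h4 : (siteOf K N q i : ℝ) ≤ siteOf K N p i + r := by exact_mod_cast (hr i).2
  have h5 := mul_le_mul_of_nonneg_left h3 hK.le
  have h6 := mul_le_mul_of_nonneg_left h4 hK.le
  rw [abs_le]
  constructor <;> linarith

theorem sum_sum_le_tsum_tsum {X : Type*} {S ξ : Set X} {T E : Finset X} (hT : (T : Set X) ⊆ S)
    (hE : (E : Set X) ⊆ ξ) (f : X → X → ℝ≥0∞) :
    ∑ p ∈ T, ∑ q ∈ E, f p q ≤ ∑' (p : ↥S) (q : ↥ξ), f p q := by
  have hin : ∀ p : X, ∑ q ∈ E, f p q ≤ ∑' q : ↥ξ, f p q := by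
    intro p
    rw [tsum_subtype ξ (f p)]
    refine le_trans (Finset.sum_le_sum fun q hq => ?_) (ENNReal.sum_le_tsum E)
    rw [Set.indicator_of_mem (hE hq)]
  refine (Finset.sum_le_sum fun p _ => hin p).trans ?_
  rw [tsum_subtype S fun p => ∑' q : ↥ξ, f p q]
  refine le_trans (Finset.sum_le_sum fun p hp => ?_) (ENNReal.sum_le_tsum T)
  rw [Set.indicator_of_mem (hT hp)]

theorem sum_sum_rate_le_Rfun {α : ℝ} {ξ A : Set (Pt d)} {T E : Finset (Pt d)}
    (hT : (T : Set (Pt d)) ⊆ ξ ∩ A) (hE : (E : Set (Pt d)) ⊆ ξ) :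
    ENNReal.ofReal (∑ p ∈ T, ∑ q ∈ E, rate α p q) ≤ Rfun α A ξ := by
  have hr : ∀ p q : Pt d, 0 ≤ rate α p q := fun p q => (Real.exp_pos _).le
  rw [ENNReal.ofReal_sum_of_nonneg fun p _ => Finset.sum_nonneg fun q _ => hr p q]
  simp_rw [ENNReal.ofReal_sum_of_nonneg fun q _ => hr _ q]
  exact sum_sum_le_tsum_tsum hT hE fun p q => ENNReal.ofReal (rate α p q)

theorem rate_self {α : ℝ} (hα : 0 < α) (p : Pt d) : rate α p p = 1 := by
  simp [rate, Real.zero_rpow hα.ne']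

theorem one_le_wgt (α : ℝ) (E : Finset (Pt d)) (p : Pt d) : 1 ≤ wgt α E 3 p := by
  simp [wgt]

theorem wgt_le_sum_rate {α : ℝ} (hα : 0 < α) {E : Finset (Pt d)} {p : Pt d} (hp : p ∈ E) :
    wgt α E 3 p ≤ ∑ q ∈ E, rate α p q := by
  have h := Finset.add_sum_erase E (rate α p) hp
  rw [rate_self hα] at h
  have h0 : 0 ≤ ∑ q ∈ E.erase p, rate α p q :=
    Finset.sum_nonneg fun q _ => (Real.exp_pos _).le
  simp only [wgt, OfNat.ofNat_ne_one, if_false, Nat.succ_ne_self]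
  rw [max_le_iff]
  constructor <;> linarith

/-- The total weight of a bounded region of `V`-cubes. -/
theorem sum_wgt_le {α : ℝ} (hα : 0 < α) {ξ : Config d} {L : ℕ} {E : Finset (Pt d)}
    (hE : ∀ p, p ∈ E ↔ p ∈ ξ ∧ p ∈ cube d L) {η C : ℝ} (hC : 0 < C) (hL : 0 < L)
    (hR : ∀ x : Fin d → ℤ, (Vcube d L η x ∩ cube d L).Nonempty →
      Rfun α (Vcube d L η x) ξ ≤ ENNReal.ofReal (C * (L : ℝ) ^ (η * d)))
    {T : Finset (Pt d)} (hTE : T ⊆ E) {b : Fin d → ℤ} {D : ℕ}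
    (hT : ∀ p ∈ T, ∀ i, b i ≤ ⌊p i / (L : ℝ) ^ η⌋ ∧ ⌊p i / (L : ℝ) ^ η⌋ ≤ b i + D) :
    ∑ p ∈ T, wgt α E 3 p ≤ (D + 1) ^ d * (C * (L : ℝ) ^ (η * d)) := by
  classical
  have hl : (0 : ℝ) < (L : ℝ) ^ η := Real.rpow_pos_of_pos (by exact_mod_cast hL) _
  set g : Pt d → Fin d → ℤ := fun p i => ⌊p i / (L : ℝ) ^ η⌋ with hg
  set Y : Finset (Fin d → ℤ) := Fintype.piFinset fun i => Finset.Icc (b i) (b i + D) with hY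
  have hYc : Y.card = (D + 1) ^ d := by
    simp only [hY, Fintype.card_piFinset, Int.card_Icc]
    rw [Finset.prod_congr rfl fun i _ => show (b i + D + 1 - b i).toNat = D + 1 by omega]
    simp
  have hcell : ∀ y ∈ Y, ∑ p ∈ T.filter (fun p => g p = y), wgt α E 3 p ≤
      C * (L : ℝ) ^ (η * d) := by
    intro y _
    have hsub : ∀ p ∈ T.filter (fun p => g p = y), p ∈ E ∧ p ∈ Vcube d L η y := by
      intro p hp
      obtain ⟨hpT, rfl⟩ := Finset.mem_filter.1 hp
      refine ⟨hTE hpT, fun i => ?_⟩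
      have h1 := (le_div_iff₀ hl).1 (Int.floor_le (p i / (L : ℝ) ^ η))
      have h2 := (div_lt_iff₀ hl).1 (Int.lt_floor_add_one (p i / (L : ℝ) ^ η))
      simp only [hg]
      constructor <;> linarith
    have hnn : (0 : ℝ) ≤ C * (L : ℝ) ^ (η * d) := by positivity
    rcases (T.filter fun p => g p = y).eq_empty_or_nonempty with h | ⟨p, hp⟩
    · rw [h]; simpa using hnn
    · have hne : (Vcube d L η y ∩ cube d L).Nonempty :=
        ⟨p, (hsub p hp).2, ((hE p).1 (hsub p hp).1).2⟩
      refine (Finset.sum_le_sum fun p hp => wgt_le_sum_rate hα (hsub p hp).1).trans ?_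
      rw [← ENNReal.ofReal_le_ofReal_iff hnn]
      refine (sum_sum_rate_le_Rfun (fun p hp => ?_) fun p hp => ?_).trans (hR y hne)
      · exact ⟨((hE p).1 (hsub p hp).1).1, (hsub p hp).2⟩
      · exact ((hE p).1 hp).1
  rw [← Finset.sum_fiberwise_of_maps_to (g := g) (t := Y)]
  · refine (Finset.sum_le_card_nsmul _ _ _ hcell).trans (le_of_eq ?_)
    rw [hYc, nsmul_eq_mul]; push_cast; rfl
  · intro p hp
    simp only [hY, Fintype.mem_piFinset, Finset.mem_Icc]
    exact hT p hp

theorem sitePacking_siteOf {ξ : Config d} {L : ℕ} {E : Finset (Pt d)}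
    (hE : ∀ p, p ∈ E ↔ p ∈ ξ ∧ p ∈ cube d L) {K : ℝ} (hK : 0 < K) {N k h s : ℕ} (hN0 : 0 < N)
    (hN : K * N ≤ (L : ℝ) / 2)
    (hfew : FewBadSites (2 * N) k (8 * d) fun x => (ξ ∩ Kcube d K (centredSite N x)).ncard ≠ 0)
    (hd : 0 < d) (hh : 0 < h) (hhs : h ≤ s) (hsn : s ≤ 2 * N) (hk : k ≤ h ^ d) :
    SitePacking E (siteOf K N) (2 * N) k h s
      fun x => (ξ ∩ Kcube d K (centredSite N x)).ncard ≠ 0 where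
  mem_box p _ := siteOf_mem_latticeBox hN0 p
  exists_of_good x hx hgood := by
    obtain ⟨p, hpξ, hp⟩ := Set.nonempty_of_ncard_ne_zero hgood
    exact ⟨p, (hE p).2 ⟨hpξ, mem_cube_of_mem_Kcube hK hN hx hp⟩, siteOf_eq_of_mem_Kcube hK hx hp⟩
  few := hfew
  dim_pos := hd
  h_pos := hh
  h_le := hhs
  s_le := hsn
  k_le := hk

/-- The total weight of a cell is comparable to its volume. -/
theorem sum_wgt_cellPts_le {α : ℝ} (hα : 0 < α) {ξ : Config d} {L : ℕ} {E : Finset (Pt d)}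
    (hE : ∀ p, p ∈ E ↔ p ∈ ξ ∧ p ∈ cube d L) {η C : ℝ} (hC : 0 < C) (hη : 0 ≤ η) (hL : 0 < L)
    (hR : ∀ x : Fin d → ℤ, (Vcube d L η x ∩ cube d L).Nonempty →
      Rfun α (Vcube d L η x) ξ ≤ ENNReal.ofReal (C * (L : ℝ) ^ (η * d)))
    {K : ℝ} (hK : 0 < K) {N s : ℕ} (hN0 : 0 < N) (hN : (L : ℝ) / 2 < K * (N + 1))
    (hs : s = ⌈(L : ℝ) ^ η⌉₊)
    {j : Fin d → ℕ} (hj : j ∈ latticeBox d (2 * N / s)) :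
    ∑ p ∈ SitePacking.cellPts E (siteOf K N) (2 * N) s j, wgt α E 3 p ≤
      (⌈12 * K⌉₊ + 2) ^ d * C * (s : ℝ) ^ d := by
  have hL1 : (1 : ℝ) ≤ L := by exact_mod_cast hL
  have hl1 : (1 : ℝ) ≤ (L : ℝ) ^ η := Real.one_le_rpow hL1 hη
  have hl : (0 : ℝ) < (L : ℝ) ^ η := by linarith
  have hls : (L : ℝ) ^ η ≤ s := by rw [hs]; exact Nat.le_ceil _
  have hsl : (s : ℝ) ≤ 2 * (L : ℝ) ^ η := by
    rw [hs]; linarith [Nat.ceil_lt_add_one hl.le]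
  have hs1 : (1 : ℝ) ≤ s := hl1.trans hls
  have hs0 : 0 < s := by exact_mod_cast zero_lt_one.trans_le hs1
  have hb := sum_wgt_le hα hE hC hL hR
    (T := SitePacking.cellPts E (siteOf K N) (2 * N) s j) (Finset.filter_subset _ _)
    (b := fun i => ⌊(K * ((j i : ℝ) * s - N) - 2 * K) / (L : ℝ) ^ η⌋) (D := ⌈12 * K⌉₊ + 1) ?_
  · refine hb.trans ?_
    rw [Real.rpow_mul (by positivity), Real.rpow_natCast]
    calc _ = (⌈12 * K⌉₊ + 2 : ℝ) ^ d * C * ((L : ℝ) ^ η) ^ d := by push_cast; ring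
      _ ≤ _ := by gcongr
  · intro p hp i
    obtain ⟨hpE, hpj⟩ := SitePacking.mem_cellPts.1 hp
    have h1 := abs_le.1 (abs_sub_siteOf_le hK hN0 hN ((hE p).1 hpE).2 i)
    have h2 := (cellOf_eq_iff hs0 hj (siteOf_mem_latticeBox hN0 p)).1 hpj i
    have h3 : siteOf K N p i ≤ j i * s + 2 * s := by
      have := h2.2
      split_ifs at this with h
      · have h4 := Nat.lt_div_mul_add (a := 2 * N) hs0
        rw [← h, add_mul] at h4
        omega
      · rw [add_mul] at this; omega
    have h4 : (j i : ℝ) * s ≤ siteOf K N p i := by exact_mod_cast h2.1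
    have h5 : (siteOf K N p i : ℝ) ≤ j i * s + 2 * s := by exact_mod_cast h3
    have h6 := mul_le_mul_of_nonneg_left h4 hK.le
    have h7 := mul_le_mul_of_nonneg_left h5 hK.le
    set A := K * ((j i : ℝ) * s - N) - 2 * K with hA
    have hA1 : A ≤ p i := by linarith
    have hA2 : p i ≤ A + 12 * K * (L : ℝ) ^ η := by
      have h8 := mul_le_mul_of_nonneg_left hsl hK.le
      have h9 := mul_le_mul_of_nonneg_left hl1 hK.le
      linarith
    refine ⟨Int.floor_le_floor (by gcongr), ?_⟩
    have h10 : p i / (L : ℝ) ^ η ≤ A / (L : ℝ) ^ η + ⌈12 * K⌉₊ := by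
      calc _ ≤ (A + 12 * K * (L : ℝ) ^ η) / (L : ℝ) ^ η := by gcongr
        _ = A / (L : ℝ) ^ η + 12 * K := by field_simp
        _ ≤ _ := by gcongr; exact Nat.le_ceil _
    have h11 := Int.floor_le_floor h10
    rw [Int.floor_add_natCast] at h11
    push_cast
    linarith

theorem SitePacking.card_le {V : Type*} [DecidableEq V] {E : Finset V} {σ : V → Fin d → ℕ}
    {n k h s : ℕ} {good : (Fin d → ℕ) → Prop} (H : SitePacking E σ n k h s good) {w : V → ℝ}
    (hw : ∀ p, 1 ≤ w p) {C : ℝ} (hC : 0 ≤ C)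
    (hwC : ∀ j ∈ latticeBox d (n / s), ∑ p ∈ cellPts E σ n s j, w p ≤ C * (s : ℝ) ^ d) :
    (E.card : ℝ) ≤ C * (n : ℝ) ^ d := by
  have h1 := H.sum_le (Finset.Subset.refl E) (fun p => zero_le_one.trans (hw p)) hwC
  have h2 : (E.card : ℝ) ≤ ∑ p ∈ E, w p := by
    simpa using Finset.card_nsmul_le_sum E w 1 fun p _ => hw p
  have h3 : (fullCells E σ n s E).card + (mixedCells E σ n s E).card ≤ (n / s) ^ d := by
    have := H.card_cells E; omega
  have h4 : ((n / s * s : ℕ) : ℝ) ≤ n := by exact_mod_cast Nat.div_mul_le_self n s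
  calc (E.card : ℝ) ≤ _ := h2.trans h1
    _ ≤ ((n / s) ^ d : ℕ) * (C * (s : ℝ) ^ d) := by gcongr
    _ = C * ((n / s * s : ℕ) : ℝ) ^ d := by push_cast; ring
    _ ≤ _ := by gcongr

theorem conduct_ge {α : ℝ} (hα : 0 < α) (hd : 2 ≤ d) {ξ : Config d} {L : ℕ} (hL : 0 < L)
    {E : Finset (Pt d)} (hE : ∀ p, p ∈ E ↔ p ∈ ξ ∧ p ∈ cube d L) {η C ε : ℝ} (hη : 0 ≤ η)
    (hηε : η * d ≤ ε / 2) (hC : 0 < C)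
    (hR : ∀ x : Fin d → ℤ, (Vcube d L η x ∩ cube d L).Nonempty →
      Rfun α (Vcube d L η x) ξ ≤ ENNReal.ofReal (C * (L : ℝ) ^ (η * d)))
    {K : ℝ} (hK : 0 < K) {N k h s : ℕ} (hNdef : N = ⌊(L : ℝ) / (2 * K)⌋₊) (hN0 : 0 < N)
    (hfew : FewBadSites (2 * N) k (8 * d) fun x => (ξ ∩ Kcube d K (centredSite N x)).ncard ≠ 0)
    (hh : 0 < h) (hhs : h ≤ s) (hsdef : s = ⌈(L : ℝ) ^ η⌉₊) (hsn : s ≤ 2 * N) (hk : k ≤ h ^ d)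
    (hs : 2 ^ (d * (d + 3) + 1) * (d * k) ^ d < (s ^ d) ^ (d - 1))
    (hc₁ : (L : ℝ) ^ (-(ε / 2)) ≤ Real.exp (-(d * (K * ((2 * h + 2 : ℕ) + 4))) ^ α))
    {C₁ κ c₀ δ : ℝ} (hC₁ : C₁ = (⌈12 * K⌉₊ + 2) ^ d * C) (hκ : 0 < κ) (hκ1 : κ ≤ 1)
    (hκC : 8 * C₁ * κ ≤ 1) (hc₀ : c₀ = Real.exp (-(d * (K * ((1 : ℕ) + 4))) ^ α)) (hδ : 0 < δ)
    (hδ1 : δ * (2 * C₁ * 2 ^ d) ≤ κ)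
    (hδ2 : δ ^ d * ((2 * C₁) ^ d * 2 ^ (d * (d + 3) + 1) * 2 ^ (d + 1) * C₁) ≤
      κ ^ (d - 1) * c₀ ^ d * K ^ d)
    {U : Finset (Pt d)} (hU : U ⊆ E) (hne : U.Nonempty) {t : ℝ} (ht : 0 < t) (ht2 : t ≤ 1 / 2)
    (hUt : (U.card : ℝ) ≤ t * E.card) :
    δ * min ((L : ℝ) ^ (-ε)) (t ^ (-(1 : ℝ) / d) / L) ≤ conduct α E 3 U := by
  have hL0 : (0 : ℝ) < L := by exact_mod_cast hL
  have hd0 : (0 : ℝ) < d := by positivity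
  have hNle : K * N ≤ (L : ℝ) / 2 := by
    have := Nat.floor_le (show (0 : ℝ) ≤ (L : ℝ) / (2 * K) by positivity)
    rw [← hNdef, le_div_iff₀ (by positivity)] at this
    linarith
  have hNlt : (L : ℝ) / 2 < K * (N + 1) := by
    have := Nat.lt_floor_add_one ((L : ℝ) / (2 * K))
    rw [← hNdef, div_lt_iff₀ (by positivity)] at this
    linarith
  have H := sitePacking_siteOf hE hK hN0 hNle hfew (by omega) hh hhs hsn hk
  have hC₁0 : 0 < C₁ := by rw [hC₁]; positivity
  have hc₀0 : 0 < c₀ := by rw [hc₀]; exact Real.exp_pos _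
  have hwC : ∀ j ∈ latticeBox d (2 * N / s),
      ∑ p ∈ SitePacking.cellPts E (siteOf K N) (2 * N) s j, wgt α E 3 p ≤ C₁ * (s : ℝ) ^ d :=
    fun j hj => by
      rw [hC₁]; exact sum_wgt_cellPts_le hα hE hC hη hL hR hK hN0 hNlt hsdef hj
  have hEc := H.card_le (one_le_wgt α E) hC₁0.le hwC
  have hrate : ∀ r : ℕ, ∀ p ∈ E, ∀ q ∈ E, (∀ i, siteOf K N p i ≤ siteOf K N q i + r ∧
      siteOf K N q i ≤ siteOf K N p i + r) →
      Real.exp (-(d * (K * (r + 4))) ^ α) ≤ rate α p q := fun r p hp q hq hr =>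
    exp_le_rate hα hK hN0 hNlt ((hE p).1 hp).2 ((hE q).1 hq).2 hr
  have hcard : 2 * U.card ≤ E.card := by
    have : (2 : ℝ) * U.card ≤ E.card := by
      have : t * (E.card : ℝ) ≤ 1 / 2 * E.card := by gcongr
      linarith
    exact_mod_cast this
  have halt := H.cut_alternative hd hs hU hcard (one_le_wgt α E) hC₁0 hwC
    (r := rate α) (fun p q => (Real.exp_pos _).le) (Real.exp_pos _).le (Real.exp_pos _).le
    hκ hκ1 hκC (hrate 1) (hrate (2 * h + 2))
  rw [← hc₀] at halt
  have hW0 : 0 < Wsum α E 3 U :=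
    Finset.sum_pos (fun p _ => zero_lt_one.trans_le (one_le_wgt α E p)) hne
  have hcut0 : 0 ≤ ∑ p ∈ U, ∑ q ∈ E \ U, rate α p q :=
    Finset.sum_nonneg fun p _ => Finset.sum_nonneg fun q _ => (Real.exp_pos _).le
  rw [conduct, le_div_iff₀ hW0]
  change κ * _ * Wsum α E 3 U ≤ _ ∨ _ * Wsum α E 3 U ^ d ≤ _ at halt
  set cut := ∑ p ∈ U, ∑ q ∈ E \ U, rate α p q with hcut
  set W := Wsum α E 3 U with hW
  rcases halt with halt | halt
  · have hsd : (s : ℝ) ^ d ≤ 2 ^ d * (L : ℝ) ^ (ε / 2) := by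
      have hL1 : (1 : ℝ) ≤ L := by exact_mod_cast hL
      have hl1 : (1 : ℝ) ≤ (L : ℝ) ^ η := Real.one_le_rpow hL1 hη
      have hsl : (s : ℝ) ≤ 2 * (L : ℝ) ^ η := by
        rw [hsdef]; linarith [Nat.ceil_lt_add_one (zero_le_one.trans hl1)]
      calc (s : ℝ) ^ d ≤ (2 * (L : ℝ) ^ η) ^ d := by gcongr
        _ = 2 ^ d * (L : ℝ) ^ (η * d) := by
          rw [mul_pow, Real.rpow_mul hL0.le, Real.rpow_natCast]
        _ ≤ _ := by gcongr
    have hpos : 0 < 2 * C₁ * (2 ^ d * (L : ℝ) ^ (ε / 2)) := by positivity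
    have hLL : (L : ℝ) ^ (-ε) * (L : ℝ) ^ (ε / 2) = (L : ℝ) ^ (-(ε / 2)) := by
      rw [← Real.rpow_add hL0]; congr 1; ring
    have hmain : (δ * (L : ℝ) ^ (-ε) * W) * (2 * C₁ * (2 ^ d * (L : ℝ) ^ (ε / 2))) ≤
        cut * (2 * C₁ * (2 ^ d * (L : ℝ) ^ (ε / 2))) := by
      calc _ = (δ * (2 * C₁ * 2 ^ d)) * ((L : ℝ) ^ (-ε) * (L : ℝ) ^ (ε / 2)) * W := by ring
        _ ≤ κ * Real.exp (-(d * (K * ((2 * h + 2 : ℕ) + 4))) ^ α) * W := by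
          rw [hLL]; gcongr
        _ ≤ _ := halt
        _ ≤ 2 * C₁ * (2 ^ d * (L : ℝ) ^ (ε / 2)) * cut := by gcongr
        _ = _ := by ring
    refine le_trans ?_ (le_of_mul_le_mul_right hmain hpos)
    gcongr
    exact min_le_left _ _
  · have hx : δ * min ((L : ℝ) ^ (-ε)) (t ^ (-(1 : ℝ) / d) / L) * W ≤
        δ * (t ^ (-(1 : ℝ) / d) / L) * W := by
      gcongr
      exact min_le_right _ _
    refine hx.trans ?_
    have hG : 0 < κ ^ (d - 1) * c₀ ^ d := by positivity
    have htd : (t ^ (-(1 : ℝ) / d)) ^ d = t⁻¹ := by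
      rw [← Real.rpow_natCast, ← Real.rpow_mul ht.le, div_mul_cancel₀ _ hd0.ne',
        Real.rpow_neg_one]
    have hUc : (U.card : ℝ) ≤ t * (C₁ * ((L : ℝ) / K) ^ d) := by
      refine hUt.trans ?_
      gcongr
      refine hEc.trans ?_
      gcongr
      rw [le_div_iff₀ hK]
      push_cast
      linarith
    refine le_of_pow_le_pow_left₀ (n := d) (by omega) hcut0 ?_
    refine le_of_mul_le_mul_left ?_ hG
    set B : ℝ := (2 * C₁) ^ d * 2 ^ (d * (d + 3) + 1) * 2 ^ (d + 1) with hB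
    have hB0 : 0 < B := by positivity
    calc κ ^ (d - 1) * c₀ ^ d * (δ * (t ^ (-(1 : ℝ) / d) / L) * W) ^ d
        = δ ^ d * (t⁻¹ / (L : ℝ) ^ d) * (κ ^ (d - 1) * c₀ ^ d * W ^ d) := by
          rw [mul_pow, mul_pow, div_pow, htd]; ring
      _ ≤ δ ^ d * (t⁻¹ / (L : ℝ) ^ d) * (B * (U.card * cut ^ d)) := by gcongr
      _ ≤ δ ^ d * (t⁻¹ / (L : ℝ) ^ d) * (B * (t * (C₁ * ((L : ℝ) / K) ^ d) * cut ^ d)) := by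
          gcongr
      _ = δ ^ d * (B * C₁) / K ^ d * cut ^ d := by
          rw [div_pow]; field_simp
      _ ≤ κ ^ (d - 1) * c₀ ^ d * K ^ d / K ^ d * cut ^ d := by gcongr
      _ = κ ^ (d - 1) * c₀ ^ d * cut ^ d := by field_simp

theorem eventually_animalSize_le (d : ℕ) :
    ∀ᶠ L : ℕ in atTop, (animalSize d L : ℝ) ≤ (6 * d + 6) * Real.log L := by
  have hlog : ∀ᶠ L : ℕ in atTop, 1 ≤ Real.log L :=
    (Real.tendsto_log_atTop.comp tendsto_natCast_atTop_atTop).eventually_ge_atTop 1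
  filter_upwards [hlog] with L hL
  have h1 : (Nat.log 2 L : ℝ) ≤ 2 * Real.log L := by
    have h2 := Real.natLog_le_logb L 2
    rw [← Real.log_div_log] at h2
    refine h2.trans ?_
    have h3 := Real.log_two_gt_d9
    push_cast
    rw [div_le_iff₀ (by linarith)]
    nlinarith
  rw [animalSize]
  push_cast
  have : (0 : ℝ) ≤ d := d.cast_nonneg
  nlinarith

theorem rpow_isLittleO_rpow {a b : ℝ} (hab : a < b) :
    Asymptotics.IsLittleO atTop (fun x : ℝ => x ^ a) (fun x : ℝ => x ^ b) := by
  refine (Asymptotics.isLittleO_iff_tendsto' ?_).2 ?_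
  · filter_upwards [eventually_gt_atTop 0] with x hx h
    exact absurd h (Real.rpow_pos_of_pos hx b).ne'
  · refine (tendsto_rpow_neg_atTop (sub_pos.2 hab)).congr' ?_
    filter_upwards [eventually_gt_atTop 0] with x hx
    rw [← Real.rpow_sub hx, neg_sub]

/-- The scales used in the proof are admissible for large `L`. -/
theorem eventually_scales (hd : 2 ≤ d) {α ε η K : ℝ} (hα : 0 < α) (hαd : α < d) (hε : 0 < ε)
    (hη : 0 < η) (hη1 : η < 1) (hK : 0 < K) :
    ∀ᶠ L : ℕ in atTop, 0 < L ∧ 0 < ⌊(L : ℝ) / (2 * K)⌋₊ ∧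
      ⌈(L : ℝ) ^ η⌉₊ ≤ 2 * ⌊(L : ℝ) / (2 * K)⌋₊ ∧
      2 ^ (d * (d + 3) + 1) * (d * animalSize d L) ^ d < (⌈(L : ℝ) ^ η⌉₊ ^ d) ^ (d - 1) ∧
      ∃ h : ℕ, 0 < h ∧ h ≤ ⌈(L : ℝ) ^ η⌉₊ ∧ animalSize d L ≤ h ^ d ∧
        (L : ℝ) ^ (-(ε / 2)) ≤ Real.exp (-(d * (K * ((2 * h + 2 : ℕ) + 4))) ^ α) := by
  have hd0 : (0 : ℝ) < d := by positivity
  have htop : Tendsto (fun L : ℕ => (L : ℝ)) atTop atTop := tendsto_natCast_atTop_atTop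
  have hlogtop : Tendsto (fun L : ℕ => Real.log L) atTop atTop :=
    Real.tendsto_log_atTop.comp htop
  set b : ℝ := 2 ^ (d * (d + 3) + 1) with hb
  have hb0 : 0 < b := by positivity
  have hb1 : 1 ≤ b := one_le_pow₀ (by norm_num)
  have e1 : ∀ᶠ L : ℕ in atTop, b * (d * ((6 * d + 6) * Real.log L)) ≤ 1 / 2 * (L : ℝ) ^ η := by
    have h := ((isLittleO_log_rpow_atTop hη).comp_tendsto htop).bound
      (show (0 : ℝ) < (2 * (b * (d * (6 * d + 6))))⁻¹ by positivity)
    filter_upwards [h, hlogtop.eventually_ge_atTop 0] with L hL hlog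
    simp only [Function.comp, Real.norm_eq_abs] at hL
    rw [abs_of_nonneg hlog, abs_of_nonneg (by positivity), inv_mul_eq_div,
      le_div_iff₀ (by positivity)] at hL
    linarith
  have e2 : ∀ᶠ L : ℕ in atTop, (L : ℝ) ^ η ≤ 1 / (2 * K) * (L : ℝ) := by
    have h := ((rpow_isLittleO_rpow hη1).comp_tendsto htop).bound
      (show (0 : ℝ) < 1 / (2 * K) by positivity)
    filter_upwards [h] with L hL
    simp only [Function.comp, Real.norm_eq_abs, Real.rpow_one] at hL
    rwa [abs_of_nonneg (by positivity), abs_of_nonneg (by positivity)] at hL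
  have e3 : ∀ᶠ L : ℕ in atTop, (d * (K * 12)) ^ α * ((6 * d + 6) * Real.log L) ^ (α / d) ≤
      ε / 2 * Real.log L := by
    have hlt : α / d < 1 := (div_lt_one hd0).2 hαd
    have h := ((rpow_isLittleO_rpow hlt).comp_tendsto hlogtop).bound
      (show (0 : ℝ) < ε / 2 / ((d * (K * 12)) ^ α * (6 * d + 6) ^ (α / d)) by positivity)
    filter_upwards [h, hlogtop.eventually_ge_atTop 0] with L hL hlog
    simp only [Function.comp, Real.norm_eq_abs, Real.rpow_one] at hL
    rw [abs_of_nonneg (by positivity), abs_of_nonneg hlog, div_mul_eq_mul_div,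
      le_div_iff₀ (by positivity)] at hL
    rw [Real.mul_rpow (by positivity) hlog]
    linarith
  filter_upwards [eventually_animalSize_le d, e1, e2, e3, htop.eventually_ge_atTop (6 * K),
    eventually_ge_atTop 1] with L hk h1 h2 h3 hLK hL
  have hL0 : (0 : ℝ) < L := by exact_mod_cast hL
  have hk1 : 1 ≤ animalSize d L := by
    rw [animalSize]; exact Nat.one_le_iff_ne_zero.2 (by positivity)
  have hkR : (1 : ℝ) ≤ animalSize d L := by exact_mod_cast hk1
  have hd1 : (1 : ℝ) ≤ d := by exact_mod_cast (by omega : 1 ≤ d)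
  have hbig : b * (d * animalSize d L) < (L : ℝ) ^ η := by
    have : b * (d * animalSize d L) ≤ b * (d * ((6 * d + 6) * Real.log L)) := by gcongr
    have : 0 < (L : ℝ) ^ η := by positivity
    linarith
  have hceil := Nat.le_ceil ((L : ℝ) ^ η)
  have hfl := Nat.lt_floor_add_one ((L : ℝ) / (2 * K))
  have hLK' : (3 : ℝ) ≤ L / (2 * K) := by
    rw [le_div_iff₀ (by positivity)]; linarith
  refine ⟨hL, ?_, ?_, ?_, ⌈(animalSize d L : ℝ) ^ (1 / d : ℝ)⌉₊, ?_, ?_, ?_, ?_⟩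
  · exact Nat.floor_pos.2 (by linarith)
  · refine Nat.ceil_le.2 ?_
    push_cast
    have : 1 / (2 * K) * (L : ℝ) = L / (2 * K) := by ring
    linarith
  · set s := ⌈(L : ℝ) ^ η⌉₊ with hs
    have h4 : b * (d * animalSize d L) < s := hbig.trans_le hceil
    have h5 : (2 : ℝ) ^ (d * (d + 3) + 1) * (d * animalSize d L) ^ d < ((s : ℝ) ^ d) ^ (d - 1) := by
      calc (2 : ℝ) ^ (d * (d + 3) + 1) * (d * animalSize d L) ^ d
          ≤ b ^ d * (d * animalSize d L) ^ d := by
            gcongr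
            exact le_self_pow₀ hb1 (by omega)
        _ = (b * (d * animalSize d L)) ^ d := (mul_pow _ _ _).symm
        _ < (s : ℝ) ^ d := by gcongr
        _ ≤ _ := by
          refine le_self_pow₀ (one_le_pow₀ ?_) (by omega)
          have : (1 : ℝ) * (1 * 1) ≤ b * (d * animalSize d L) := by gcongr
          linarith
    exact_mod_cast h5
  · exact Nat.ceil_pos.2 (by positivity)
  · refine Nat.ceil_le_ceil ?_
    calc (animalSize d L : ℝ) ^ (1 / d : ℝ) ≤ (animalSize d L : ℝ) ^ (1 : ℝ) := by
          gcongr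
          rw [div_le_one hd0]; exact hd1
      _ = 1 * (1 * animalSize d L) := by simp
      _ ≤ b * (d * animalSize d L) := by gcongr
      _ ≤ _ := hbig.le
  · have h4 := Nat.le_ceil ((animalSize d L : ℝ) ^ (1 / d : ℝ))
    have h5 : (animalSize d L : ℝ) ≤ (⌈(animalSize d L : ℝ) ^ (1 / d : ℝ)⌉₊ : ℝ) ^ d := by
      calc (animalSize d L : ℝ) = ((animalSize d L : ℝ) ^ (1 / d : ℝ)) ^ d := by
            rw [← Real.rpow_natCast, ← Real.rpow_mul (by positivity),
              div_mul_cancel₀ _ hd0.ne', Real.rpow_one]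
        _ ≤ _ := by gcongr
    exact_mod_cast h5
  · set y := (animalSize d L : ℝ) ^ (1 / d : ℝ) with hy
    have hy1 : 1 ≤ y := Real.one_le_rpow hkR (by positivity)
    have h4 : (⌈y⌉₊ : ℝ) ≤ y + 1 := (Nat.ceil_lt_add_one (by positivity)).le
    have h5 : ((2 * ⌈y⌉₊ + 2 : ℕ) : ℝ) + 4 ≤ 12 * y := by push_cast; linarith
    have h6 : (d * (K * (((2 * ⌈y⌉₊ + 2 : ℕ) : ℝ) + 4))) ^ α ≤ ε / 2 * Real.log L := by
      calc _ ≤ (d * (K * (12 * y))) ^ α := by gcongr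
        _ = (d * (K * 12)) ^ α * (animalSize d L : ℝ) ^ (α / d) := by
          rw [show d * (K * (12 * y)) = d * (K * 12) * y by ring,
            Real.mul_rpow (by positivity) (by positivity), hy, ← Real.rpow_mul (by positivity)]
          congr 2; ring
        _ ≤ (d * (K * 12)) ^ α * ((6 * d + 6) * Real.log L) ^ (α / d) := by gcongr
        _ ≤ _ := h3
    rw [Real.rpow_def_of_pos hL0]
    refine Real.exp_le_exp.2 ?_
    linarith

/-- Lemma 3.3: the hybrid conductance profile `ψ_L` satisfies the bound of Theorem 1.1. -/
theorem stmt_10 (hd : 2 ≤ d) (α : ℝ) (hα0 : 0 < α) (hαd : α < d)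
    (P : Measure (Config d)) (hP : IsPointProcess P)
    (hA1 : AssumptionA1 P) (hA2 : AssumptionA2 α P) (ε : ℝ) (hε : 0 < ε) :
    ∃ δ : ℝ, 0 < δ ∧ ∀ᵐ ξ ∂P, ∀ᶠ L : ℕ in atTop,
      ∀ hfin : (ξ ∩ cube d L).Finite, ∀ t : ℝ, 0 < t → t ≤ 1 / 2 →
        ENNReal.ofReal (δ * min ((L : ℝ) ^ (-ε)) (t ^ (-(1 : ℝ) / d) / L)) ≤
          hybridProfile α hfin.toFinset t := by
  have hd0 : (0 : ℝ) < d := by positivity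
  set η : ℝ := min (ε / (2 * d)) (1 / 2) with hη
  have hη0 : 0 < η := lt_min (by positivity) (by norm_num)
  have hη1 : η < 1 := (min_le_right _ _).trans_lt (by norm_num)
  have hηε : η * d ≤ ε / 2 := by
    calc η * d ≤ ε / (2 * d) * d := by gcongr; exact min_le_left _ _
      _ = _ := by field_simp
  obtain ⟨K, hK, hfew⟩ := hA1.ae_fewBadSites hP (by omega)
  obtain ⟨C, hC, hR⟩ := hA2 η hη0 hη1
  obtain ⟨C₁, hC₁⟩ : ∃ C₁ : ℝ, C₁ = (⌈12 * K⌉₊ + 2) ^ d * C := ⟨_, rfl⟩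
  obtain ⟨c₀, hc₀⟩ : ∃ c₀ : ℝ, c₀ = Real.exp (-(d * (K * ((1 : ℕ) + 4))) ^ α) := ⟨_, rfl⟩
  have hC₁0 : 0 < C₁ := by rw [hC₁]; positivity
  have hc₀0 : 0 < c₀ := by rw [hc₀]; exact Real.exp_pos _
  obtain ⟨κ, hκ, hκ1, hκC⟩ : ∃ κ : ℝ, 0 < κ ∧ κ ≤ 1 ∧ 8 * C₁ * κ ≤ 1 := by
    refine ⟨min 1 (8 * C₁)⁻¹, lt_min one_pos (by positivity), min_le_left _ _, ?_⟩
    calc _ ≤ 8 * C₁ * (8 * C₁)⁻¹ := by gcongr; exact min_le_right _ _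
      _ = 1 := mul_inv_cancel₀ (by positivity)
  set B : ℝ := (2 * C₁) ^ d * 2 ^ (d * (d + 3) + 1) * 2 ^ (d + 1) * C₁ with hB
  have hB0 : 0 < B := by positivity
  obtain ⟨δ, hδ, hδ1, hδ2⟩ : ∃ δ : ℝ, 0 < δ ∧ δ * (2 * C₁ * 2 ^ d) ≤ κ ∧
      δ ^ d * B ≤ κ ^ (d - 1) * c₀ ^ d * K ^ d := by
    have hG : 0 < κ ^ (d - 1) * c₀ ^ d * K ^ d := by positivity
    refine ⟨min 1 (min (κ / (2 * C₁ * 2 ^ d)) (κ ^ (d - 1) * c₀ ^ d * K ^ d / B)),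
      by positivity, ?_, ?_⟩
    · rw [← le_div_iff₀ (by positivity)]
      exact (min_le_right _ _).trans (min_le_left _ _)
    · rw [← le_div_iff₀ hB0]
      refine (pow_le_of_le_one (by positivity) (min_le_left _ _) (by omega)).trans ?_
      exact (min_le_right _ _).trans (min_le_right _ _)
  refine ⟨δ, hδ, ?_⟩
  filter_upwards [hfew, hR] with ξ hfew hR
  filter_upwards [hfew, hR, eventually_scales hd hα0 hαd hε hη0 hη1 hK] with L hfew hR hsc
  intro hfin t ht ht2
  obtain ⟨hL, hN0, hsn, hs, h, hh, hhs, hk, hc₁⟩ := hsc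
  refine le_iInf fun U => le_iInf fun hU => le_iInf fun hne => le_iInf fun hUt =>
    ENNReal.ofReal_le_ofReal ?_
  exact conduct_ge hα0 hd hL (fun p => by simp) hη0.le hηε hC hR hK rfl hN0 hfew hh hhs rfl hsn
    hk hs hc₁ hC₁ hκ hκ1 hκC hc₀ hδ hδ1 hδ2 hU hne ht ht2 hUt

end
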